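/- Let Ω ⊂ ℂ^N be a bounded strongly pseudoconvex domain with C^{2,α}-smooth boundary, α ∈ (0,1]. Then there exists a constant c > 0, depending only on Ω, such that for all z, w ∈ Ω: log(1 + c·‖(z−w)_z‖ / (δ_Ω(z)^{1/2}·δ_Ω(w)^{1/2})) ≤ k_Ω(z,w), where k_Ω is the Kobayashi distance of Ω. -/

import Mathlib

open Metric Set Filter Topology MeasureTheory

noncomputable section

namespace InvDist

/-- Complex Euclidean `N`-space. -/
abbrev E (N : ℕ) := EuclideanSpace ℂ (Fin N)

variable {N : ℕ}

/-- The paper's Hermitian product `⟨a,b⟩ = ∑ a_j * conj (b_j)`. -/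
def herm (a b : E N) : ℂ := ∑ j, a j * (starRingEnd ℂ) (b j)

/-- Euclidean distance to the boundary of `Ω`. -/
def bdist (Ω : Set (E N)) (x : E N) : ℝ := Metric.infDist x (frontier Ω)

/-- `π` selects, for each point of `Ω`, a closest point on the boundary. -/
def IsClosestPointSelection (Ω : Set (E N)) (π : E N → E N) : Prop :=
  ∀ z ∈ Ω, π z ∈ frontier Ω ∧ dist z (π z) = bdist Ω z

/-- `‖v_z‖`: modulus of the complex normal component of `v` with respect to the
closest boundary point `π z`; the outer unit normal at `π z` is `(π z - z)/‖π z - z‖`. -/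
def ncomp (Ω : Set (E N)) (π : E N → E N) (z v : E N) : ℝ :=
  ‖herm v (π z - z)‖ / bdist Ω z

/-- `‖v_z^ℝ‖`: modulus of the real normal component of `v` at `π z`. -/
def ncompR (Ω : Set (E N)) (π : E N → E N) (z v : E N) : ℝ :=
  |(herm v (π z - z)).re| / bdist Ω z

/-- The quantity `A_Ω(z,w)`. -/
def Afun (Ω : Set (E N)) (π : E N → E N) (z w : E N) : ℝ :=
  (ncomp Ω π z (z - w) + ‖z - w‖ ^ 2 + ‖z - w‖ * Real.sqrt (bdist Ω z)) /
    (Real.sqrt (bdist Ω z) * Real.sqrt (bdist Ω w))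

/-- `h_Ω(z,w) = ‖(z-w)_z‖ + ‖z-w‖ δ_Ω(z)^{1/2}`. -/
def hfun (Ω : Set (E N)) (π : E N → E N) (z w : E N) : ℝ :=
  ncomp Ω π z (z - w) + ‖z - w‖ * Real.sqrt (bdist Ω z)

/-- real analogue of `h_Ω`. -/
def hfunR (Ω : Set (E N)) (π : E N → E N) (z w : E N) : ℝ :=
  ncompR Ω π z (z - w) + ‖z - w‖ * Real.sqrt (bdist Ω z)

/-- inverse hyperbolic tangent -/
def artanh (x : ℝ) : ℝ := Real.log ((1 + x) / (1 - x)) / 2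

/-- The Lempert function of `Ω`. -/
def lempert (Ω : Set (E N)) (z w : E N) : ℝ :=
  artanh (sInf { r : ℝ | ∃ φ : ℂ → E N, DifferentiableOn ℂ φ (ball 0 1) ∧
    MapsTo φ (ball (0:ℂ) 1) Ω ∧ φ 0 = z ∧ ∃ a ∈ ball (0:ℂ) 1, φ a = w ∧ r = ‖a‖ })

/-- The Carathéodory distance of `Ω`. -/
def caratheodory (Ω : Set (E N)) (z w : E N) : ℝ :=
  artanh (sSup { r : ℝ | ∃ f : E N → ℂ, DifferentiableOn ℂ f Ω ∧
    MapsTo f Ω (ball (0:ℂ) 1) ∧ f z = 0 ∧ r = ‖f w‖ })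

/-- The Kobayashi distance: the largest pseudodistance not exceeding the Lempert
function, given as an infimum over chains. -/
def kobayashi (Ω : Set (E N)) (z w : E N) : ℝ :=
  sInf { r : ℝ | ∃ (n : ℕ) (p : Fin (n + 1) → E N), p 0 = z ∧ p (Fin.last n) = w ∧
    (∀ i, p i ∈ Ω) ∧ r = ∑ i : Fin n, lempert Ω (p i.castSucc) (p i.succ) }

/-- The Poincaré distance on the unit disc. -/
def poincare (ζ ξ : ℂ) : ℝ := artanh ‖(ζ - ξ) / (1 - (starRingEnd ℂ) ζ * ξ)‖

/-- A complex geodesic of `Ω`. -/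
def IsComplexGeodesic (Ω : Set (E N)) (φ : ℂ → E N) : Prop :=
  DifferentiableOn ℂ φ (ball 0 1) ∧ MapsTo φ (ball (0:ℂ) 1) Ω ∧
    ∀ ζ ∈ ball (0:ℂ) 1, ∀ ξ ∈ ball (0:ℂ) 1, kobayashi Ω (φ ζ) (φ ξ) = poincare ζ ξ

/-- `ρ` is `C^k` on `U` with `α`-Hölder `k`-th derivative. -/
def IsCkHolderOn (k : ℕ) (α : ℝ) (ρ : E N → ℝ) (U : Set (E N)) : Prop :=
  ContDiffOn ℝ k ρ U ∧ ∃ M : ℝ, ∀ x ∈ U, ∀ y ∈ U,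
    ‖iteratedFDeriv ℝ k ρ x - iteratedFDeriv ℝ k ρ y‖ ≤ M * ‖x - y‖ ^ α

/-- The Levi form of `ρ` at `p` evaluated at `v`. -/
def levi (ρ : E N → ℝ) (p v : E N) : ℝ :=
  (iteratedFDeriv ℝ 2 ρ p ![v, v] +
    iteratedFDeriv ℝ 2 ρ p ![(Complex.I : ℂ) • v, (Complex.I : ℂ) • v]) / 4

/-- Bounded strongly pseudoconvex domain with `C^{k,α}`-smooth boundary. -/
def IsStronglyPseudoconvexDomain (k : ℕ) (α : ℝ) (Ω : Set (E N)) : Prop :=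
  IsOpen Ω ∧ IsConnected Ω ∧ Bornology.IsBounded Ω ∧
  ∃ (U : Set (E N)) (ρ : E N → ℝ), IsOpen U ∧ closure Ω ⊆ U ∧
    IsCkHolderOn k α ρ U ∧ Ω = {x ∈ U | ρ x < 0} ∧
    (∀ p ∈ frontier Ω, fderiv ℝ ρ p ≠ 0) ∧
    ∀ p ∈ frontier Ω, ∀ v : E N, v ≠ 0 → fderiv ℝ ρ p v = 0 →
      fderiv ℝ ρ p ((Complex.I : ℂ) • v) = 0 → 0 < levi ρ p v

/-- `η` is the outer unit normal of `Ω` at the boundary point `p`. -/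
def IsOuterUnitNormalAt (Ω : Set (E N)) (p η : E N) : Prop :=
  ‖η‖ = 1 ∧ p ∈ frontier Ω ∧ ∃ ε > 0, ∀ t : ℝ, 0 < t → t < ε →
    p - t • η ∈ Ω ∧ bdist Ω (p - t • η) = t

open Classical in
/-- signed boundary distance -/
def signedDist (Ω : Set (E N)) (x : E N) : ℝ :=
  if x ∈ closure Ω then -(bdist Ω x) else bdist Ω x

/-- Hessian quadratic form of the signed boundary distance. -/
def hessSD (Ω : Set (E N)) (p v : E N) : ℝ :=
  iteratedFDeriv ℝ 2 (signedDist Ω) p ![v, v]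

/-- strict linear convexity at `p` (with outer unit normal `η`). -/
def StrictlyLinearlyConvexAt (Ω : Set (E N)) (p η : E N) : Prop :=
  ∀ v : E N, v ≠ 0 → herm v η = 0 → 0 < hessSD Ω p v

/-- strong convexity at `p` (with outer unit normal `η`). -/
def StronglyConvexAt (Ω : Set (E N)) (p η : E N) : Prop :=
  ∀ v : E N, v ≠ 0 → (herm v η).re = 0 → 0 < hessSD Ω p v

/-- `p` is a `C^k`-smooth boundary point of `Ω`. -/
def IsCkBoundaryPoint (k : ℕ) (Ω : Set (E N)) (p : E N) : Prop :=
  p ∈ frontier Ω ∧ ∃ (U : Set (E N)) (ρ : E N → ℝ), IsOpen U ∧ p ∈ U ∧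
    ContDiffOn ℝ k ρ U ∧ (∀ x ∈ U, (x ∈ Ω ↔ ρ x < 0)) ∧
    ∀ x ∈ U ∩ frontier Ω, fderiv ℝ ρ x ≠ 0

/-- bounded domain with `C^k`-smooth boundary. -/
def IsCkDomain (k : ℕ) (Ω : Set (E N)) : Prop :=
  IsOpen Ω ∧ IsConnected Ω ∧ Bornology.IsBounded Ω ∧
    ∀ p ∈ frontier Ω, IsCkBoundaryPoint k Ω p

/-- bounded domain with `C^{1,1}`-smooth boundary. -/
def IsC11Domain (Ω : Set (E N)) : Prop :=
  IsOpen Ω ∧ IsConnected Ω ∧ Bornology.IsBounded Ω ∧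
  ∀ p ∈ frontier Ω, ∃ (U : Set (E N)) (ρ : E N → ℝ), IsOpen U ∧ p ∈ U ∧
    IsCkHolderOn 1 1 ρ U ∧ (∀ x ∈ U, (x ∈ Ω ↔ ρ x < 0)) ∧
    ∀ x ∈ U ∩ frontier Ω, fderiv ℝ ρ x ≠ 0

/-- `p` is a `C^{2,α}`-smooth strongly pseudoconvex boundary point of `Ω`. -/
def IsSPSCBoundaryPoint (α : ℝ) (Ω : Set (E N)) (p : E N) : Prop :=
  p ∈ frontier Ω ∧ ∃ (U : Set (E N)) (ρ : E N → ℝ), IsOpen U ∧ p ∈ U ∧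
    IsCkHolderOn 2 α ρ U ∧ (∀ x ∈ U, (x ∈ Ω ↔ ρ x < 0)) ∧
    (∀ x ∈ U ∩ frontier Ω, fderiv ℝ ρ x ≠ 0) ∧
    ∀ x ∈ U ∩ frontier Ω, ∀ v : E N, v ≠ 0 → fderiv ℝ ρ x v = 0 →
      fderiv ℝ ρ x ((Complex.I : ℂ) • v) = 0 → 0 < levi ρ x v

instance (N : ℕ) : MeasurableSpace (E N) := borel _

instance (N : ℕ) : BorelSpace (E N) := ⟨rfl⟩

/-- Lebesgue measure on `E N`. -/
def vol (N : ℕ) : Measure (E N) :=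
  letI : InnerProductSpace ℝ (E N) := InnerProductSpace.rclikeToReal ℂ (E N)
  letI : MeasureSpace (E N) := measureSpaceOfInnerProductSpace
  volume

/-- Bergman kernel on the diagonal. -/
def bergmanKernelDiag (Ω : Set (E N)) (z : E N) : ℝ :=
  sSup { r : ℝ | ∃ f : E N → ℂ, DifferentiableOn ℂ f Ω ∧
    (∫ x in Ω, ‖f x‖ ^ 2 ∂(vol N)) ≤ 1 ∧ r = ‖f z‖ ^ 2 }

/-- `M_Ω(z;v)`. -/
def bergmanM (Ω : Set (E N)) (z v : E N) : ℝ :=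
  sSup { r : ℝ | ∃ f : E N → ℂ, DifferentiableOn ℂ f Ω ∧
    (∫ x in Ω, ‖f x‖ ^ 2 ∂(vol N)) ≤ 1 ∧ f z = 0 ∧ r = ‖fderiv ℂ f z v‖ }

/-- The Bergman metric. -/
def bergmanMetric (Ω : Set (E N)) (z v : E N) : ℝ :=
  bergmanM Ω z v / Real.sqrt (bergmanKernelDiag Ω z)

/-- The Bergman distance: inner distance of the Bergman metric. -/
def bergmanDist (Ω : Set (E N)) (z w : E N) : ℝ :=
  sInf { r : ℝ | ∃ γ : ℝ → E N, ContDiffOn ℝ 1 γ (Icc 0 1) ∧ γ 0 = z ∧ γ 1 = w ∧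
    (∀ t ∈ Icc (0:ℝ) 1, γ t ∈ Ω) ∧
    r = ∫ t in (0:ℝ)..(1:ℝ), bergmanMetric Ω (γ t) (derivWithin γ (Icc 0 1) t) }


/-- Holomorphic discs in `Ω`. -/
def IsDisc (Ω : Set (E N)) (φ : ℂ → E N) : Prop :=
  DifferentiableOn ℂ φ (ball 0 1) ∧ MapsTo φ (ball (0:ℂ) 1) Ω

/-- `Φ` is infinitesimally `1`-Lipschitz along every holomorphic disc in `Ω`. -/
def DiscLipschitz (Ω : Set (E N)) (Φ : E N → ℝ) : Prop :=
  ∀ φ, IsDisc Ω φ → ∀ ε > 0, ∀ᶠ ζ in 𝓝 (0:ℂ), |Φ (φ ζ) - Φ (φ 0)| ≤ (1 + ε) * ‖ζ‖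

/-- The disc automorphism taking `0` to `b`. -/
def mobius (b ζ : ℂ) : ℂ := (ζ + b) / (1 + (starRingEnd ℂ) b * ζ)

lemma one_add_conj_mul_ne_zero {b ζ : ℂ} (hb : ‖b‖ < 1) (hζ : ‖ζ‖ < 1) :
    1 + (starRingEnd ℂ) b * ζ ≠ 0 := by
  intro h
  have h1 : (starRingEnd ℂ) b * ζ = -1 := by linear_combination h
  have h2 : ‖b‖ * ‖ζ‖ = 1 := by
    have := congrArg norm h1
    simpa using this
  nlinarith [norm_nonneg b, norm_nonneg ζ]

lemma norm_mobius_lt_one {b ζ : ℂ} (hb : ‖b‖ < 1) (hζ : ‖ζ‖ < 1) : ‖mobius b ζ‖ < 1 := by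
  have h0 := one_add_conj_mul_ne_zero hb hζ
  rw [mobius, norm_div, div_lt_one (norm_pos_iff.2 h0)]
  have hb2 : b.re ^ 2 + b.im ^ 2 < 1 := by
    have := Complex.sq_norm b
    rw [Complex.normSq_apply] at this
    nlinarith [norm_nonneg b]
  have hz2 : ζ.re ^ 2 + ζ.im ^ 2 < 1 := by
    have := Complex.sq_norm ζ
    rw [Complex.normSq_apply] at this
    nlinarith [norm_nonneg ζ]
  refine lt_of_pow_lt_pow_left₀ 2 (norm_nonneg _) ?_
  rw [Complex.sq_norm, Complex.sq_norm, Complex.normSq_apply, Complex.normSq_apply]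
  simp only [Complex.add_re, Complex.add_im, Complex.mul_re, Complex.mul_im, Complex.conj_re,
    Complex.conj_im, Complex.one_re, Complex.one_im]
  nlinarith [mul_pos (sub_pos.2 hb2) (sub_pos.2 hz2)]

lemma IsDisc.comp_mobius {Ω : Set (E N)} {φ : ℂ → E N} (hφ : IsDisc Ω φ) {b : ℂ}
    (hb : ‖b‖ < 1) : IsDisc Ω (fun ζ => φ (mobius b ζ)) := by
  have hm : MapsTo (mobius b) (ball (0:ℂ) 1) (ball (0:ℂ) 1) := fun ζ hζ => by
    simpa using norm_mobius_lt_one hb (by simpa using hζ)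
  refine ⟨hφ.1.comp ?_ hm, hφ.2.comp hm⟩
  intro ζ hζ
  have h0 := one_add_conj_mul_ne_zero hb (ζ := ζ) (by simpa using hζ)
  unfold mobius
  exact (DifferentiableAt.div (differentiableAt_id.add_const b)
    ((differentiableAt_id.const_mul _).const_add 1) h0).differentiableWithinAt

lemma DiscLipschitz.eventually_le {Ω : Set (E N)} {Φ : E N → ℝ} (h : DiscLipschitz Ω Φ)
    {φ : ℂ → E N} (hφ : IsDisc Ω φ) {b : ℂ} (hb : ‖b‖ < 1) {ε : ℝ} (hε : 0 < ε) :
    ∀ᶠ η in 𝓝 b, |Φ (φ η) - Φ (φ b)| ≤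
      (1 + ε) * ‖(η - b) / (1 - (starRingEnd ℂ) b * η)‖ := by
  have h1 := h _ (hφ.comp_mobius hb) ε hε
  have hb0 : (1:ℂ) - (starRingEnd ℂ) b * b ≠ 0 := by
    have := one_add_conj_mul_ne_zero (b := b) (ζ := -b) hb (by simpa using hb)
    simpa [sub_eq_add_neg] using this
  have hc : ContinuousAt (fun η : ℂ => (η - b) / (1 - (starRingEnd ℂ) b * η)) b :=
    ContinuousAt.div (by fun_prop) (by fun_prop) hb0
  have ht : Tendsto (fun η : ℂ => (η - b) / (1 - (starRingEnd ℂ) b * η)) (𝓝 b) (𝓝 0) := by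
    simpa [ContinuousAt] using hc
  have hne : ∀ᶠ η in 𝓝 b, (1:ℂ) - (starRingEnd ℂ) b * η ≠ 0 :=
    ContinuousAt.eventually_ne (by fun_prop) hb0
  filter_upwards [ht.eventually h1, hne] with η h2 h3
  have e1 : mobius b ((η - b) / (1 - (starRingEnd ℂ) b * η)) = η := by
    have e2 : (η - b) / (1 - (starRingEnd ℂ) b * η) + b =
        η * ((1 - (starRingEnd ℂ) b * b) / (1 - (starRingEnd ℂ) b * η)) := by
      rw [div_add' _ _ _ h3, ← mul_div_assoc]; congr 1; ring
    have e3 : 1 + (starRingEnd ℂ) b * ((η - b) / (1 - (starRingEnd ℂ) b * η)) =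
        (1 - (starRingEnd ℂ) b * b) / (1 - (starRingEnd ℂ) b * η) := by
      rw [← mul_div_assoc, add_div' _ _ _ h3]; congr 1; ring
    rw [mobius, e2, e3]
    exact mul_div_cancel_right₀ _ (div_ne_zero hb0 h3)
  have e0 : mobius b 0 = b := by simp [mobius]
  simpa only [e1, e0] using h2

lemma artanh_eq {x : ℝ} (hx : 0 ≤ x) (hx1 : x < 1) : artanh x = Real.artanh x := by
  rw [Real.artanh_eq_half_log ⟨by linarith, by linarith⟩, artanh]; ring

lemma DiscLipschitz.le_artanh {Ω : Set (E N)} {Φ : E N → ℝ} (h : DiscLipschitz Ω Φ)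
    {φ : ℂ → E N} (hφ : IsDisc Ω φ) {a : ℂ} (ha : ‖a‖ < 1) :
    Φ (φ a) - Φ (φ 0) ≤ artanh ‖a‖ := by
  have hin : ∀ τ ∈ Icc (0:ℝ) 1, ‖(τ:ℂ) * a‖ < 1 := by
    intro τ hτ
    rw [norm_mul, Complex.norm_real, Real.norm_of_nonneg hτ.1]
    nlinarith [hτ.1, hτ.2, norm_nonneg a]
  have hcont : ∀ b : ℂ, ‖b‖ < 1 → ContinuousAt (fun η => Φ (φ η)) b := by
    intro b hb
    have h1 := h.eventually_le hφ hb one_pos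
    have hb0 : (1:ℂ) - (starRingEnd ℂ) b * b ≠ 0 := by
      have := one_add_conj_mul_ne_zero (b := b) (ζ := -b) hb (by simpa using hb)
      simpa [sub_eq_add_neg] using this
    have hc : ContinuousAt (fun η : ℂ => (1 + 1) * ‖(η - b) / (1 - (starRingEnd ℂ) b * η)‖) b :=
      continuousAt_const.mul (ContinuousAt.norm (ContinuousAt.div (by fun_prop) (by fun_prop) hb0))
    have ht : Tendsto (fun η : ℂ => (1 + 1) * ‖(η - b) / (1 - (starRingEnd ℂ) b * η)‖) (𝓝 b)
        (𝓝 (0:ℝ)) := by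
      simpa [ContinuousAt] using hc
    rw [ContinuousAt, tendsto_iff_dist_tendsto_zero]
    exact squeeze_zero' (Eventually.of_forall fun _ => dist_nonneg)
      (by simpa [Real.dist_eq] using h1) ht
  set A := ‖a‖ with hA
  have hA0 : 0 ≤ A := norm_nonneg a
  have hden : ∀ τ ∈ Icc (0:ℝ) 1, 0 < 1 - τ ^ 2 * A ^ 2 := by
    intro τ hτ
    have : τ * A < 1 := by nlinarith [hτ.1, hτ.2]
    have h0 : 0 ≤ τ * A := mul_nonneg hτ.1 hA0
    nlinarith
  have key := image_le_of_liminf_slope_right_le_deriv_boundary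
    (f := fun τ : ℝ => Φ (φ ((τ:ℂ) * a))) (a := 0) (b := 1)
    (B := fun τ : ℝ => Φ (φ 0) + (Real.log (1 + τ * A) - Real.log (1 - τ * A)) / 2)
    (B' := fun τ => A / (1 - τ ^ 2 * A ^ 2)) ?_ ?_ ?_ ?_ ?_
  · have h2 := key (x := 1) (by simp)
    simp only [Complex.ofReal_one, one_mul] at h2
    rw [artanh, Real.log_div (by positivity) (by linarith)]
    linarith
  · intro τ hτ
    refine ContinuousAt.continuousWithinAt ?_
    exact ContinuousAt.comp (f := fun τ : ℝ => (τ:ℂ) * a) (hcont _ (hin τ hτ)) (by fun_prop)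
  · simp
  · have : ∀ τ ∈ Icc (0:ℝ) 1, τ * A < 1 := fun τ hτ => by nlinarith [hτ.1, hτ.2]
    refine ContinuousOn.add continuousOn_const (ContinuousOn.div_const (ContinuousOn.sub ?_ ?_) _)
    · exact ContinuousOn.log (by fun_prop) fun τ hτ => by
        have := mul_nonneg hτ.1 hA0
        linarith
    · exact ContinuousOn.log (by fun_prop) fun τ hτ => by
        have := this τ hτ
        linarith
  · intro τ hτ
    have hτ' : τ ∈ Icc (0:ℝ) 1 := ⟨hτ.1, hτ.2.le⟩
    have hp1 : 0 < 1 + τ * A := by have := mul_nonneg hτ.1 hA0; linarith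
    have hp2 : 0 < 1 - τ * A := by nlinarith [hτ.1, hτ.2]
    refine HasDerivAt.hasDerivWithinAt ?_
    have d1 : HasDerivAt (fun τ : ℝ => Real.log (1 + τ * A)) (A / (1 + τ * A)) τ := by
      have := (((hasDerivAt_id τ).mul_const A).const_add 1).log hp1.ne'
      simpa using this
    have d2 : HasDerivAt (fun τ : ℝ => Real.log (1 - τ * A)) (-A / (1 - τ * A)) τ := by
      have := (((hasDerivAt_id τ).mul_const A).const_sub 1).log hp2.ne'
      simpa using this
    refine (((d1.sub d2).div_const 2).const_add (Φ (φ 0))).congr_deriv ?_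
    have e : 1 - τ ^ 2 * A ^ 2 = (1 + τ * A) * (1 - τ * A) := by ring
    rw [e, div_sub_div _ _ hp1.ne' hp2.ne', div_div,
      div_eq_div_iff (by positivity) (by positivity)]
    ring
  · intro τ hτ r hr
    have hτ' : τ ∈ Icc (0:ℝ) 1 := ⟨hτ.1, hτ.2.le⟩
    have hd := hden τ hτ'
    obtain ⟨ε, hε, hεr⟩ : ∃ ε > 0, (1 + ε) * (A / (1 - τ ^ 2 * A ^ 2)) < r := by
      have ht : Tendsto (fun ε : ℝ => (1 + ε) * (A / (1 - τ ^ 2 * A ^ 2))) (𝓝[>] 0)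
          (𝓝 ((1 + 0) * (A / (1 - τ ^ 2 * A ^ 2)))) :=
        ((by fun_prop : Continuous fun ε : ℝ =>
          (1 + ε) * (A / (1 - τ ^ 2 * A ^ 2))).tendsto 0).mono_left nhdsWithin_le_nhds
      have := (ht.eventually (gt_mem_nhds (by simpa using hr))).and self_mem_nhdsWithin
      obtain ⟨ε, h1, h2⟩ := this.exists
      exact ⟨ε, h2, h1⟩
    have h1 := h.eventually_le hφ (hin τ hτ') hε
    have hmap : Tendsto (fun σ : ℝ => (σ:ℂ) * a) (𝓝[>] τ) (𝓝 ((τ:ℂ) * a)) :=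
      ((by fun_prop : Continuous fun σ : ℝ => (σ:ℂ) * a).tendsto τ).mono_left nhdsWithin_le_nhds
    have hlim : ∀ᶠ σ in 𝓝[>] τ, (1 + ε) * (A / (1 - τ * σ * A ^ 2)) < r := by
      have hc : ContinuousAt (fun σ : ℝ => (1 + ε) * (A / (1 - τ * σ * A ^ 2))) τ := by
        refine continuousAt_const.mul (ContinuousAt.div (by fun_prop) (by fun_prop) ?_)
        nlinarith
      have := hc.eventually (gt_mem_nhds (show (1 + ε) * (A / (1 - τ * τ * A ^ 2)) < r by
        simpa [← sq] using hεr))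
      exact this.filter_mono nhdsWithin_le_nhds
    have hpos : ∀ᶠ σ in 𝓝[>] τ, 0 < 1 - τ * σ * A ^ 2 := by
      have hc : ContinuousAt (fun σ : ℝ => 1 - τ * σ * A ^ 2) τ := by fun_prop
      exact (hc.eventually (lt_mem_nhds (by nlinarith))).filter_mono nhdsWithin_le_nhds
    refine Eventually.frequently ?_
    filter_upwards [hmap.eventually h1, hlim, hpos, self_mem_nhdsWithin] with σ h2 h3 h4 h5
    have h5 : τ < σ := h5
    rw [slope_def_field, div_lt_iff₀ (sub_pos.2 h5)]
    have e1 : (starRingEnd ℂ) ((τ:ℂ) * a) * ((σ:ℂ) * a) = ((τ * σ * A ^ 2 : ℝ) : ℂ) := by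
      rw [map_mul, Complex.conj_ofReal]
      have := Complex.conj_mul' a
      push_cast
      rw [hA]
      linear_combination (τ:ℂ) * σ * this
    have e2 : ‖((σ:ℂ) * a - (τ:ℂ) * a) / (1 - (starRingEnd ℂ) ((τ:ℂ) * a) * ((σ:ℂ) * a))‖ =
        A / (1 - τ * σ * A ^ 2) * (σ - τ) := by
      have e3 : (1:ℂ) - ((τ * σ * A ^ 2 : ℝ) : ℂ) = ((1 - τ * σ * A ^ 2 : ℝ) : ℂ) := by
        push_cast; ring
      have e4 : (σ:ℂ) * a - (τ:ℂ) * a = ((σ - τ : ℝ) : ℂ) * a := by push_cast; ring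
      rw [e1, e3, e4, norm_div, norm_mul, Complex.norm_real, Complex.norm_real,
        Real.norm_of_nonneg h4.le, Real.norm_of_nonneg (sub_pos.2 h5).le]
      ring
    rw [e2] at h2
    calc _ ≤ |Φ (φ ((σ:ℂ) * a)) - Φ (φ ((τ:ℂ) * a))| := le_abs_self _
      _ ≤ (1 + ε) * (A / (1 - τ * σ * A ^ 2) * (σ - τ)) := h2
      _ = (1 + ε) * (A / (1 - τ * σ * A ^ 2)) * (σ - τ) := by ring
      _ < r * (σ - τ) := by
        exact mul_lt_mul_of_pos_right h3 (sub_pos.2 h5)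

/-- Any two points of `Ω` lie on a common holomorphic disc. -/
def DiscConnected (Ω : Set (E N)) : Prop :=
  ∀ z ∈ Ω, ∀ w ∈ Ω, ∃ φ, IsDisc Ω φ ∧ φ 0 = z ∧ ∃ a ∈ ball (0:ℂ) 1, φ a = w

lemma DiscLipschitz.le_lempert {Ω : Set (E N)} (hc : DiscConnected Ω) {Φ : E N → ℝ}
    (h : DiscLipschitz Ω Φ) {z w : E N} (hz : z ∈ Ω) (hw : w ∈ Ω) :
    Φ w - Φ z ≤ lempert Ω z w := by
  unfold lempert
  set S := { r : ℝ | ∃ φ : ℂ → E N, DifferentiableOn ℂ φ (ball 0 1) ∧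
    MapsTo φ (ball (0:ℂ) 1) Ω ∧ φ 0 = z ∧ ∃ a ∈ ball (0:ℂ) 1, φ a = w ∧ r = ‖a‖ } with hS
  have hlb : ∀ r ∈ S, 0 ≤ r := by
    rintro r ⟨φ, -, -, -, a, -, -, rfl⟩; exact norm_nonneg a
  have hlt : ∀ r ∈ S, r < 1 := by
    rintro r ⟨φ, -, -, -, a, ha, -, rfl⟩; simpa using ha
  have hne : S.Nonempty := by
    obtain ⟨φ, hφ, h0, a, ha, haw⟩ := hc z hz w hw
    exact ⟨‖a‖, φ, hφ.1, hφ.2, h0, a, ha, haw, rfl⟩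
  have hle : ∀ r ∈ S, Φ w - Φ z ≤ artanh r := by
    rintro r ⟨φ, h1, h2, rfl, a, ha, rfl, rfl⟩
    exact h.le_artanh ⟨h1, h2⟩ (by simpa using ha)
  have hs0 : 0 ≤ sInf S := le_csInf hne hlb
  have hs1 : sInf S < 1 := by
    obtain ⟨r, hr⟩ := hne
    exact (csInf_le ⟨0, hlb⟩ hr).trans_lt (hlt r hr)
  have ht : Real.tanh (Φ w - Φ z) ≤ sInf S := by
    refine le_csInf hne fun r hr => ?_
    have h1 := hle r hr
    rw [artanh_eq (hlb r hr) (hlt r hr), ← Real.artanh_tanh (Φ w - Φ z),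
      Real.artanh_le_artanh_iff ⟨Real.neg_one_lt_tanh _, Real.tanh_lt_one _⟩
        ⟨by linarith [hlb r hr], hlt r hr⟩] at h1
    exact h1
  rw [artanh_eq hs0 hs1, ← Real.artanh_tanh (Φ w - Φ z)]
  exact Real.artanh_le_artanh (Real.neg_one_lt_tanh _) hs1 ht

lemma DiscLipschitz.sub_le_kobayashi {Ω : Set (E N)} (hc : DiscConnected Ω) {Φ : E N → ℝ}
    (h : DiscLipschitz Ω Φ) {z w : E N} (hz : z ∈ Ω) (hw : w ∈ Ω) :
    Φ w - Φ z ≤ kobayashi Ω z w := by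
  refine le_csInf ⟨_, 1, ![z, w], rfl, rfl, ?_, rfl⟩ ?_
  · intro i; fin_cases i <;> simpa
  · rintro r ⟨n, p, rfl, rfl, hp, rfl⟩
    calc Φ (p (Fin.last n)) - Φ (p 0) = ∑ i : Fin n, (Φ (p i.succ) - Φ (p i.castSucc)) := by
          rw [Finset.sum_sub_distrib]
          have h1 := Fin.sum_univ_succ fun i => Φ (p i)
          have h2 := Fin.sum_univ_castSucc fun i => Φ (p i)
          linarith
      _ ≤ _ := Finset.sum_le_sum fun i _ => h.le_lempert hc (hp _) (hp _)

lemma DiscLipschitz.neg {Ω : Set (E N)} {Φ : E N → ℝ} (h : DiscLipschitz Ω Φ) :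
    DiscLipschitz Ω fun x => -Φ x := by
  intro φ hφ ε hε
  filter_upwards [h φ hφ ε hε] with ζ hζ
  rwa [show -Φ (φ ζ) - -Φ (φ 0) = -(Φ (φ ζ) - Φ (φ 0)) by ring, abs_neg]

lemma DiscLipschitz.abs_sub_le_kobayashi {Ω : Set (E N)} (hc : DiscConnected Ω) {Φ : E N → ℝ}
    (h : DiscLipschitz Ω Φ) {z w : E N} (hz : z ∈ Ω) (hw : w ∈ Ω) :
    |Φ w - Φ z| ≤ kobayashi Ω z w :=
  abs_le.2 ⟨by linarith [h.neg.sub_le_kobayashi hc hz hw], h.sub_le_kobayashi hc hz hw⟩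

open unitInterval in
lemma exists_entire_curve {Ω : Set (E N)} (ho : IsOpen Ω) (hc : IsConnected Ω) {z w : E N}
    (hz : z ∈ Ω) (hw : w ∈ Ω) :
    ∃ P : ℂ → E N, Differentiable ℂ P ∧ P 0 = z ∧ P 1 = w ∧
      ∀ t ∈ Icc (0:ℝ) 1, P t ∈ Ω := by
  have hj : JoinedIn Ω z w := ((ho.isConnected_iff_isPathConnected).1 hc).joinedIn z hz w hw
  obtain ⟨γ, hγ⟩ := hj
  let g : C(I, E N) := γ.toContinuousMap
  have hg0 : g 0 = z := γ.source
  have hg1 : g 1 = w := γ.target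
  have hcomp : IsCompact (range g) := isCompact_range g.continuous
  have hsub : range g ⊆ Ω := by rintro _ ⟨t, rfl⟩; exact hγ t
  obtain ⟨δ, hδ, hth⟩ := hcomp.exists_thickening_subset_open ho hsub
  have hev : ∀ᶠ n in atTop, bernsteinApproximation n g ∈ ball g δ :=
    (bernsteinApproximation_uniform g).eventually (ball_mem_nhds g hδ)
  obtain ⟨n, hn, hn0⟩ := (hev.and (eventually_ge_atTop 1)).exists
  refine ⟨fun ζ => ∑ k : Fin (n + 1), ((n.choose k : ℂ) * ζ ^ (k : ℕ) * (1 - ζ) ^ (n - k)) •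
    g (bernstein.z k), ?_, ?_, ?_, ?_⟩
  · fun_prop
  · rw [← hg0]
    simp [Fin.sum_univ_succ]
  · rw [← hg1]
    simp [Fin.sum_univ_castSucc, Nat.sub_eq_zero_iff_le, bernstein.z_last (n := n) (by omega)]
  · intro t ht
    have h1 : (∑ k : Fin (n + 1), ((n.choose k : ℂ) * (t:ℂ) ^ (k : ℕ) * (1 - (t:ℂ)) ^ (n - k)) •
        g (bernstein.z k)) = bernsteinApproximation n g ⟨t, ht⟩ := by
      rw [bernsteinApproximation.apply]
      refine Finset.sum_congr rfl fun k _ => ?_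
      rw [bernstein_apply, ← Complex.coe_smul]
      push_cast
      rfl
    simp only [h1]
    refine hth (mem_thickening_iff.2 ⟨g ⟨t, ht⟩, mem_range_self _, ?_⟩)
    exact lt_of_le_of_lt (ContinuousMap.dist_apply_le_dist _) hn

/-- A disc that stretches over a thin neighbourhood of a compact real segment. -/
lemma exists_disc_near_segment {V : Set ℂ} (hV : IsOpen V)
    (h : ∀ t ∈ Icc (0:ℝ) 1, (t:ℂ) ∈ V) :
    ∃ ψ : ℂ → ℂ, DifferentiableOn ℂ ψ (ball 0 1) ∧ MapsTo ψ (ball 0 1) V ∧ ψ 0 = 0 ∧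
      ∃ a ∈ ball (0:ℂ) 1, ψ a = 1 := by
  have hcpt : IsCompact ((fun t : ℝ => (t:ℂ)) '' Icc (0:ℝ) 1) :=
    isCompact_Icc.image Complex.continuous_ofReal
  obtain ⟨δ, hδ, hth⟩ := hcpt.exists_thickening_subset_open hV
    (by rintro _ ⟨t, ht, rfl⟩; exact h t ht)
  have hlim : Tendsto (fun y : ℝ => Real.exp y - 1) (𝓝 0) (𝓝 0) := by
    have : Continuous (fun y : ℝ => Real.exp y - 1) := by fun_prop
    simpa using this.tendsto 0
  obtain ⟨η, hη, hηs⟩ := Metric.eventually_nhds_iff.1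
    (hlim.eventually (gt_mem_nhds hδ))
  set ε := η / 4 with hε
  have hε0 : 0 < ε := by positivity
  have hstrip : ∀ u : ℂ, |u.im| < η → (1 - Complex.cos u) / 2 ∈ V := by
    intro u hu
    refine hth (mem_thickening_iff.2 ⟨(((1 - Real.cos u.re) / 2 : ℝ) : ℂ),
      ⟨_, ⟨?_, ?_⟩, rfl⟩, ?_⟩)
    · linarith [Real.cos_le_one u.re]
    · linarith [Real.neg_one_le_cos u.re]
    · have h1 : (1 - Complex.cos u) / 2 - (((1 - Real.cos u.re) / 2 : ℝ) : ℂ) =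
          (Complex.cos u.re - Complex.cos u) / 2 := by push_cast; ring
      rw [dist_eq_norm, h1, norm_div, Complex.norm_two]
      have h2 : ‖Complex.cos u.re - Complex.cos u‖ ≤ Real.exp |u.im| - 1 := by
        have hfact : Complex.cos u.re - Complex.cos u =
            (Complex.exp (u.re * Complex.I) * (1 - Complex.exp ((-u.im : ℝ))) +
              Complex.exp (-u.re * Complex.I) * (1 - Complex.exp (u.im))) / 2 := by
          conv_lhs => rw [show Complex.cos u = Complex.cos (u.re + u.im * Complex.I) by
            rw [Complex.re_add_im]]
          rw [Complex.cos, Complex.cos, mul_sub, mul_sub, ← Complex.exp_add, ← Complex.exp_add]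
          have e1 : (u.re + u.im * Complex.I) * Complex.I =
              u.re * Complex.I + ((-u.im : ℝ) : ℂ) := by
            push_cast
            linear_combination (u.im : ℂ) * Complex.I_mul_I
          have e2 : -(u.re + u.im * Complex.I) * Complex.I =
              -u.re * Complex.I + (u.im : ℂ) := by
            linear_combination -(u.im : ℂ) * Complex.I_mul_I
          rw [e1, e2]
          ring
        have hb : ∀ y : ℝ, |y| = |u.im| → ‖1 - Complex.exp y‖ ≤ Real.exp |u.im| - 1 := by
          intro y hy
          rw [← hy, show (1:ℂ) - Complex.exp y = ((1 - Real.exp y : ℝ) : ℂ) by push_cast; ring,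
            Complex.norm_real, Real.norm_eq_abs, abs_le]
          have h3 : Real.exp y ≤ Real.exp |y| := Real.exp_le_exp.2 (le_abs_self y)
          have h4 : Real.exp (-|y|) ≤ Real.exp y := Real.exp_le_exp.2 (neg_abs_le y)
          have h5 : 2 ≤ Real.exp |y| + Real.exp (-|y|) := by
            have h6 := Real.exp_pos |y|
            have h7 : Real.exp |y| * Real.exp (-|y|) = 1 := by rw [← Real.exp_add]; simp
            nlinarith [sq_nonneg (Real.exp |y| - 1), Real.exp_pos (-|y|)]
          constructor <;> linarith
        rw [hfact, norm_div, Complex.norm_two]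
        have n1 : ‖Complex.exp (u.re * Complex.I)‖ = 1 := Complex.norm_exp_ofReal_mul_I _
        have n2 : ‖Complex.exp (-u.re * Complex.I)‖ = 1 := by
          have := Complex.norm_exp_ofReal_mul_I (-u.re)
          rwa [Complex.ofReal_neg] at this
        have := norm_add_le (Complex.exp (u.re * Complex.I) * (1 - Complex.exp ((-u.im : ℝ))))
          (Complex.exp (-u.re * Complex.I) * (1 - Complex.exp (u.im)))
        rw [norm_mul, norm_mul, n1, n2] at this
        have h8 := hb (-u.im) (abs_neg _)
        have h9 := hb u.im rfl
        linarith
      have h3 := hηs (y := |u.im|) (by simpa using hu)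
      have h4 : 0 ≤ Real.exp |u.im| - 1 := (norm_nonneg _).trans h2
      linarith
  have hre : ∀ ζ ∈ ball (0:ℂ) 1, 0 < ((1 + ζ) / (1 - ζ)).re := by
    intro ζ hζ
    have hn : ‖ζ‖ < 1 := by simpa using hζ
    have hsq : ζ.re * ζ.re + ζ.im * ζ.im < 1 := by
      rw [← Complex.normSq_apply, ← Complex.sq_norm]; nlinarith [norm_nonneg ζ]
    have hne : (1:ℂ) - ζ ≠ 0 := by
      intro h0
      have : ζ = 1 := by linear_combination -h0
      rw [this] at hn; simp at hn
    rw [Complex.div_re, ← add_div]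
    apply div_pos _ (Complex.normSq_pos.2 hne)
    simp
    nlinarith
  refine ⟨fun ζ => (1 - Complex.cos (ε * Complex.log ((1 + ζ) / (1 - ζ)))) / 2, ?_, ?_, ?_, ?_⟩
  · intro ζ hζ
    have hne : (1:ℂ) - ζ ≠ 0 := by
      intro h0
      have := hre ζ hζ
      rw [h0] at this; simp at this
    have hs : (1 + ζ) / (1 - ζ) ∈ Complex.slitPlane := Or.inl (hre ζ hζ)
    have h1 : DifferentiableAt ℂ (fun ζ : ℂ => (1 + ζ) / (1 - ζ)) ζ := by
      fun_prop (disch := assumption)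
    have h2 := (h1.clog hs).const_mul (ε : ℂ)
    exact ((((differentiableAt_const (1:ℂ)).sub h2.ccos)).div_const 2).differentiableWithinAt
  · intro ζ hζ
    apply hstrip
    have h1 : |(Complex.log ((1 + ζ) / (1 - ζ))).im| < Real.pi / 2 := by
      rw [Complex.log_im]
      exact Complex.abs_arg_lt_pi_div_two_iff.2 (Or.inl (hre ζ hζ))
    rw [Complex.im_ofReal_mul, abs_mul, abs_of_pos hε0]
    have : Real.pi < 4 := Real.pi_lt_four
    nlinarith
  · simp
  · set b := Real.exp (Real.pi / ε) with hb
    have hb0 : 0 < b := Real.exp_pos _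
    refine ⟨(((b - 1) / (b + 1) : ℝ) : ℂ), ?_, ?_⟩
    · rw [mem_ball_zero_iff, Complex.norm_real, Real.norm_eq_abs, abs_lt]
      constructor
      · rw [lt_div_iff₀ (by positivity)]; linarith
      · rw [div_lt_one (by positivity)]; linarith
    · have h1 : ((1:ℂ) + (((b - 1) / (b + 1) : ℝ) : ℂ)) / (1 - (((b - 1) / (b + 1) : ℝ) : ℂ))
          = (b : ℂ) := by
        norm_cast
        have : (1:ℝ) - (b - 1) / (b + 1) ≠ 0 := by
          rw [one_sub_div (by positivity)]
          apply ne_of_gt; apply div_pos <;> linarith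
        rw [div_eq_iff this]
        field_simp
        ring
      simp only [h1]
      rw [← Complex.ofReal_log hb0.le, hb, Real.log_exp]
      have : (ε:ℂ) * ((Real.pi / ε : ℝ) : ℂ) = (Real.pi : ℂ) := by
        norm_cast; field_simp
      rw [this, Complex.cos_pi]; norm_num

lemma discConnected {Ω : Set (E N)} (ho : IsOpen Ω) (hc : IsConnected Ω) : DiscConnected Ω := by
  intro z hz w hw
  obtain ⟨P, hP, h0, h1, hPΩ⟩ := exists_entire_curve ho hc hz hw
  obtain ⟨ψ, hψ, hψV, hψ0, a, ha, hψa⟩ :=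
    exists_disc_near_segment (ho.preimage hP.continuous) hPΩ
  exact ⟨fun ζ => P (ψ ζ), ⟨hP.comp_differentiableOn hψ, hψV⟩, by simp [hψ0, h0], a, ha,
    by simp [hψa, h1]⟩

lemma exists_entire_re_eq_of_mem_span {F : C(UnitAddCircle, ℂ)}
    (hF : F ∈ Submodule.span ℂ (range (@fourier (1:ℝ)))) :
    ∀ c : ℂ, ∃ P : ℂ → ℂ, Differentiable ℂ P ∧
      ∀ x : UnitAddCircle, (c * F x).re = (P (AddCircle.toCircle x)).re := by
  induction hF using Submodule.span_induction with
  | mem F hF =>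
    obtain ⟨n, rfl⟩ := hF
    intro c
    rcases Int.eq_nat_or_neg n with ⟨k, rfl | rfl⟩
    · refine ⟨fun ζ => c * ζ ^ k, by fun_prop, fun x => ?_⟩
      rw [fourier_apply, AddCircle.toCircle_zsmul]
      simp
    · refine ⟨fun ζ => (starRingEnd ℂ) c * ζ ^ k, by fun_prop, fun x => ?_⟩
      rw [fourier_apply, AddCircle.toCircle_zsmul, ← Complex.conj_re (_ * _), map_mul]
      congr 2
      rw [zpow_neg, zpow_natCast, Circle.coe_inv_eq_conj, Complex.conj_conj, Circle.coe_pow]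
  | zero => exact fun c => ⟨fun _ => 0, by fun_prop, by simp⟩
  | add F G _ _ hF hG =>
    intro c
    obtain ⟨P, hP, h1⟩ := hF c
    obtain ⟨Q, hQ, h2⟩ := hG c
    refine ⟨fun ζ => P ζ + Q ζ, hP.add hQ, fun x => ?_⟩
    rw [ContinuousMap.add_apply, mul_add, Complex.add_re, Complex.add_re, h1, h2]
  | smul a F _ hF =>
    intro c
    obtain ⟨P, hP, h1⟩ := hF (c * a)
    refine ⟨P, hP, fun x => ?_⟩
    rw [← h1, ContinuousMap.smul_apply, smul_eq_mul, mul_assoc]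

lemma exists_entire_re_close {F : ℂ → ℝ} {R : ℝ} (hR : 0 < R)
    (hF : ContinuousOn F (sphere 0 R)) {ε : ℝ} (hε : 0 < ε) :
    ∃ P : ℂ → ℂ, Differentiable ℂ P ∧ ∀ ζ ∈ sphere (0:ℂ) R, |(P ζ).re - F ζ| < ε := by
  have hc : Continuous fun x : UnitAddCircle => ((F (R * (AddCircle.toCircle x : ℂ)) : ℝ) : ℂ) := by
    refine Complex.continuous_ofReal.comp (hF.comp_continuous ?_ fun x => ?_)
    · exact continuous_const.mul
        (continuous_subtype_val.comp AddCircle.continuous_toCircle)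
    · simp [abs_of_pos hR, Circle.norm_coe]
  let f : C(UnitAddCircle, ℂ) := ⟨_, hc⟩
  have hf : f ∈ (Submodule.span ℂ (range (@fourier (1:ℝ)))).topologicalClosure := by
    rw [span_fourier_closure_eq_top]; trivial
  rw [← SetLike.mem_coe, Submodule.topologicalClosure_coe, Metric.mem_closure_iff] at hf
  obtain ⟨G, hG, hfG⟩ := hf ε hε
  obtain ⟨P, hP, h1⟩ := exists_entire_re_eq_of_mem_span hG 1
  refine ⟨fun ζ => P (ζ / R), hP.comp (by fun_prop), fun ζ hζ => ?_⟩
  have hn : ‖ζ‖ = R := by simpa using hζ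
  have hR' : (R:ℂ) ≠ 0 := by exact_mod_cast hR.ne'
  have hz : ‖ζ / R‖ = 1 := by
    rw [norm_div, hn, Complex.norm_real, Real.norm_of_nonneg hR.le, div_self hR.ne']
  obtain ⟨x, hx⟩ := (AddCircle.homeomorphCircle (T := (1:ℝ)) one_ne_zero).surjective
    ⟨ζ / R, by simpa [Submonoid.unitSphere] using hz⟩
  rw [AddCircle.homeomorphCircle_apply] at hx
  have hx' : (AddCircle.toCircle x : ℂ) = ζ / R := by rw [hx]
  have h2 := (ContinuousMap.dist_apply_le_dist (f := f) (g := G) x).trans_lt hfG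
  have h3 : f x = (F ζ : ℂ) := by
    change ((F (R * (AddCircle.toCircle x : ℂ)) : ℝ) : ℂ) = _
    rw [hx', mul_div_cancel₀ _ hR']
  change |(P (ζ / R)).re - F ζ| < ε
  rw [← hx', ← h1 x, one_mul]
  rw [dist_comm, dist_eq_norm, h3] at h2
  calc |(G x).re - F ζ| = |(G x - (F ζ : ℂ)).re| := by simp
    _ ≤ ‖G x - (F ζ : ℂ)‖ := Complex.abs_re_le_norm _
    _ < ε := h2

/-- Near each point of `s`, `w` lies below the real part of a holomorphic function which
agrees with it at that point. -/
def TouchedAbove (w : ℂ → ℝ) (s : Set ℂ) : Prop :=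
  ∀ ζ ∈ s, ∃ g : ℂ → ℂ, (∀ᶠ ξ in 𝓝 ζ, DifferentiableAt ℂ g ξ ∧ w ξ ≤ (g ξ).re) ∧
    w ζ = (g ζ).re

lemma TouchedAbove.re_le {w : ℂ → ℝ} {R : ℝ} (hR : 0 < R)
    (hw : ContinuousOn w (closedBall 0 R)) (ht : TouchedAbove w (ball 0 R))
    {P : ℂ → ℂ} (hP : Differentiable ℂ P) (hb : ∀ ζ ∈ sphere (0:ℂ) R, (P ζ).re ≤ w ζ) :
    (P 0).re ≤ w 0 := by
  refine le_of_forall_pos_le_add fun ε₀ hε₀ => ?_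
  set ε := ε₀ / R ^ 2 with hε_def
  have hε : 0 < ε := by positivity
  have hv : ContinuousOn (fun ζ => w ζ - (P ζ).re - ε * ‖ζ‖ ^ 2) (closedBall 0 R) := by
    have := hP.continuous
    fun_prop
  obtain ⟨b, hb1, hmin⟩ := (isCompact_closedBall (0:ℂ) R).exists_isMinOn
    ⟨0, by simp [hR.le]⟩ hv
  have h0 : w b - (P b).re - ε * ‖b‖ ^ 2 ≤ w 0 - (P 0).re := by
    have := hmin (a := 0) (by simp [hR.le])
    simpa using this
  rcases (mem_closedBall_zero_iff.1 hb1).lt_or_eq with hlt | heq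
  · exfalso
    obtain ⟨g, hg, hgb⟩ := ht b (by simpa using hlt)
    set G : ℂ → ℂ := fun ζ => Complex.exp (-(g ζ - P ζ - 2 * ε * (starRingEnd ℂ) b * ζ)) with hG
    have hnorm : ∀ ζ, ‖G ζ‖ =
        Real.exp (-((g ζ).re - (P ζ).re - 2 * ε * (b.re * ζ.re + b.im * ζ.im))) := by
      intro ζ
      rw [hG, Complex.norm_exp]
      congr 1
      simp only [Complex.neg_re, Complex.sub_re, Complex.mul_re, Complex.mul_im, Complex.re_ofNat,
        Complex.im_ofNat, Complex.ofReal_re, Complex.ofReal_im, Complex.conj_re, Complex.conj_im]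
      ring
    have hkey : ∀ᶠ ζ in 𝓝 b,
        ‖G ζ‖ ≤ Real.exp (-((g b).re - (P b).re - 2 * ε * (b.re * b.re + b.im * b.im))
          - ε * ‖ζ - b‖ ^ 2) := by
      filter_upwards [hg, isOpen_ball.mem_nhds (show b ∈ ball (0:ℂ) R by simpa using hlt)]
        with ζ hζ hζR
      have h1 := hmin (a := ζ) (ball_subset_closedBall hζR)
      simp only [mem_ofPred_eq] at h1
      rw [hnorm, Real.exp_le_exp]
      rw [Complex.sq_norm, Complex.sq_norm, Complex.normSq_apply, Complex.normSq_apply] at h1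
      rw [Complex.sq_norm, Complex.normSq_apply, Complex.sub_re, Complex.sub_im]
      nlinarith [hζ.2]
    have hmax : IsLocalMax (norm ∘ G) b := by
      filter_upwards [hkey] with ζ hζ
      refine hζ.trans ?_
      simp only [Function.comp_apply]
      rw [hnorm b, Real.exp_le_exp]
      nlinarith [sq_nonneg ‖ζ - b‖]
    have hd : ∀ᶠ ζ in 𝓝 b, DifferentiableAt ℂ G ζ := by
      filter_upwards [hg] with ζ hζ
      have h1 := hζ.1
      have h2 := hP.differentiableAt (x := ζ)
      have h3 : DifferentiableAt ℂ (fun ζ : ℂ => 2 * ε * (starRingEnd ℂ) b * ζ) ζ :=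
        differentiableAt_id.const_mul _
      exact ((h1.sub h2).sub h3).neg.cexp
    have hconst := Complex.eventually_eq_of_isLocalMax_norm hd hmax
    have h5 : ∀ᶠ ζ in 𝓝 b, ζ = b := by
      filter_upwards [hconst, hkey] with ζ h1 h2
      rw [h1, hnorm b, Real.exp_le_exp] at h2
      have h3 : ‖ζ - b‖ ^ 2 ≤ 0 := by
        by_contra! h
        nlinarith [mul_pos hε h]
      have h4 : ‖ζ - b‖ = 0 := by nlinarith [norm_nonneg (ζ - b)]
      exact sub_eq_zero.1 (norm_eq_zero.1 h4)
    have h6 : ({b} : Set ℂ) ∈ 𝓝 b := h5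
    have h7 : IsOpen ({b} : Set ℂ) := isOpen_iff_mem_nhds.2 (by rintro x rfl; exact h6)
    exact not_isOpen_singleton b h7
  · have h1 := hb b (by simpa using heq)
    rw [heq, hε_def, div_mul_cancel₀ _ (by positivity)] at h0
    linarith

lemma TouchedAbove.circleAverage_le {w : ℂ → ℝ} {R : ℝ} (hR : 0 < R)
    (hw : ContinuousOn w (closedBall 0 R)) (ht : TouchedAbove w (ball 0 R)) :
    Real.circleAverage w 0 R ≤ w 0 := by
  refine le_of_forall_pos_le_add fun ε hε => ?_
  have hw' := hw.mono (sphere_subset_closedBall (x := (0:ℂ)) (ε := R))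
  obtain ⟨P, hP, hPw⟩ := exists_entire_re_close hR hw' (half_pos hε)
  have h1 := ht.re_le hR hw (P := fun ζ => P ζ - (ε / 2 : ℝ)) (hP.sub_const _) (fun ζ hζ => by
    have := (abs_lt.1 (hPw ζ hζ)).2
    simp only [Complex.sub_re, Complex.ofReal_re]
    linarith)
  have hPi : CircleIntegrable P 0 R := hP.continuous.continuousOn.circleIntegrable hR.le
  have h2 : Real.circleAverage (fun ζ => (P ζ).re) 0 R = (P 0).re := by
    have := Complex.reCLM.circleAverage_comp_comm hPi
    rw [(hP.diffContOnCl (s := ball 0 |R|)).circleAverage] at this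
    exact this
  have h3 : Real.circleAverage w 0 R ≤ Real.circleAverage (fun ζ => (P ζ).re + ε / 2) 0 R := by
    apply Real.circleAverage_mono (hw'.circleIntegrable hR.le)
    · have := hP.continuous
      exact Continuous.continuousOn (by fun_prop) |>.circleIntegrable hR.le
    · intro ζ hζ
      rw [abs_of_pos hR] at hζ
      have := (abs_lt.1 (hPw ζ hζ)).1
      linarith
  rw [Real.circleAverage_fun_add, Real.circleAverage_const, h2] at h3
  · simp only [Complex.sub_re, Complex.ofReal_re] at h1
    linarith
  · have := hP.continuous
    exact Continuous.continuousOn (by fun_prop) |>.circleIntegrable hR.le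
  · exact continuousOn_const.circleIntegrable hR.le

lemma sq_norm_le_circleAverage {F : ℂ → E N} (hF : DifferentiableOn ℂ F (ball 0 1)) {R : ℝ}
    (hR : 0 < R) (hR1 : R < 1) {h : ℂ → ℝ} (hh : ContinuousOn h (sphere 0 R))
    (hFh : ∀ ζ ∈ sphere (0:ℂ) R, ‖F ζ‖ ^ 2 ≤ h ζ) {b : ℂ} (hb : ‖b‖ < R) :
    ‖F b‖ ^ 2 ≤ R / (R - ‖b‖) * Real.circleAverage h 0 R := by
  obtain ⟨e, he, heb⟩ := exists_dual_vector'' ℂ (F b)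
  have hsub : closure (ball (0:ℂ) |R|) ⊆ ball 0 1 := by
    rw [abs_of_pos hR]
    exact closure_ball_subset_closedBall.trans (closedBall_subset_ball hR1)
  set f : ℂ → ℂ := fun ζ => (e (F ζ)) ^ 2 with hf
  have hfd : DifferentiableOn ℂ f (ball 0 1) := (e.differentiable.comp_differentiableOn hF).pow 2
  have hmean := ((hfd.mono hsub).diffContOnCl).circleAverage_smul_div (w := b)
    (by simpa [abs_of_pos hR] using hb)
  have hfb : f b = ((‖F b‖ ^ 2 : ℝ) : ℂ) := by
    simp only [hf]
    rw [heb]; push_cast; rfl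
  have hne : ∀ ζ ∈ sphere (0:ℂ) R, ζ - b ≠ 0 := by
    intro ζ hζ h0
    rw [sub_eq_zero.1 h0] at hζ
    simp at hζ; linarith
  have hss : sphere (0:ℂ) R ⊆ ball 0 1 :=
    sphere_subset_closedBall.trans (closedBall_subset_ball hR1)
  have hi : CircleIntegrable (fun ζ => ((ζ - 0) / (ζ - b)) • f ζ) 0 R := by
    refine ContinuousOn.circleIntegrable hR.le ?_
    have := hfd.continuousOn.mono hss
    exact ContinuousOn.smul (ContinuousOn.div (by fun_prop) (by fun_prop) hne) this
  have h1 := Complex.reCLM.circleAverage_comp_comm hi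
  rw [hmean, hfb, Complex.reCLM_apply, Complex.ofReal_re] at h1
  rw [← h1, ← smul_eq_mul, ← Real.circleAverage_fun_smul]
  apply Real.circleAverage_mono
  · refine ContinuousOn.circleIntegrable hR.le ?_
    have := hfd.continuousOn.mono hss
    exact Complex.reCLM.continuous.comp_continuousOn
      (ContinuousOn.smul (ContinuousOn.div (by fun_prop) (by fun_prop) hne) this)
  · exact ContinuousOn.circleIntegrable hR.le (hh.const_smul (R / (R - ‖b‖)))
  · intro ζ hζ
    rw [abs_of_pos hR] at hζ
    have hn : ‖ζ‖ = R := by simpa using hζ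
    simp only [Function.comp_apply, Complex.reCLM_apply, smul_eq_mul]
    refine (Complex.re_le_norm _).trans ?_
    rw [norm_mul, norm_div, sub_zero, hn, hf, norm_pow]
    have h2 : ‖e (F ζ)‖ ≤ ‖F ζ‖ := by
      simpa using e.le_of_opNorm_le he (F ζ)
    have h3 : R - ‖b‖ ≤ ‖ζ - b‖ := by
      rw [← hn]; exact norm_sub_norm_le ζ b
    have h4 : 0 < R - ‖b‖ := by linarith
    have h5 : ‖e (F ζ)‖ ^ 2 ≤ h ζ :=
      (pow_le_pow_left₀ (norm_nonneg _) h2 2).trans (hFh ζ hζ)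
    have h6 : 0 ≤ ‖e (F ζ)‖ ^ 2 := by positivity
    gcongr

/-- The Schwarz lemma for maps into the left half-plane. -/
lemma norm_deriv_le_of_re_neg {G : ℂ → ℂ} {R : ℝ} (hR : 0 < R)
    (hG : DifferentiableOn ℂ G (ball 0 R)) (hre : ∀ ζ ∈ ball (0:ℂ) R, (G ζ).re < 0) :
    ‖deriv G 0‖ ≤ 2 * -(G 0).re / R := by
  have h0 : (0:ℂ) ∈ ball (0:ℂ) R := by simpa using hR
  set H : ℂ → ℂ := fun ζ => (G ζ - G 0) / (G ζ + (starRingEnd ℂ) (G 0)) with hH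
  have hden : ∀ ζ ∈ ball (0:ℂ) R, G ζ + (starRingEnd ℂ) (G 0) ≠ 0 := by
    intro ζ hζ h
    have := congrArg Complex.re h
    simp at this
    linarith [hre ζ hζ, hre 0 h0]
  have hHd : DifferentiableOn ℂ H (ball 0 R) :=
    (hG.sub_const _).div (hG.add_const _) hden
  have hH0 : H 0 = 0 := by simp [hH]
  have hmaps : MapsTo H (ball 0 R) (closedBall (H 0) 1) := by
    intro ζ hζ
    rw [hH0, mem_closedBall_zero_iff, hH, norm_div]
    refine div_le_one_of_le₀ ?_ (norm_nonneg _)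
    rw [← abs_of_nonneg (norm_nonneg (G ζ - G 0)),
      ← abs_of_nonneg (norm_nonneg (G ζ + (starRingEnd ℂ) (G 0))), ← sq_le_sq, Complex.sq_norm,
      Complex.sq_norm, Complex.normSq_apply, Complex.normSq_apply]
    simp
    nlinarith [mul_pos_of_neg_of_neg (hre ζ hζ) (hre 0 h0)]
  have hbound := Complex.norm_deriv_le_div_of_mapsTo_ball hHd hmaps hR
  have hGd : HasDerivAt G (deriv G 0) 0 :=
    (hG.differentiableAt (isOpen_ball.mem_nhds h0)).hasDerivAt
  have hderiv : deriv H 0 = deriv G 0 / (2 * (G 0).re : ℝ) := by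
    have h1 := ((hGd.sub_const (G 0)).div (hGd.add_const ((starRingEnd ℂ) (G 0)))
      (hden 0 h0)).deriv
    have h2 : G 0 + (starRingEnd ℂ) (G 0) = ((2 * (G 0).re : ℝ) : ℂ) := Complex.add_conj _
    have h3 : ((2 * (G 0).re : ℝ) : ℂ) ≠ 0 := by rw [← h2]; exact hden 0 h0
    refine h1.trans ?_
    rw [h2, sub_self, zero_mul, sub_zero, sq, mul_div_mul_right _ _ h3]
  have hneg := hre 0 h0
  rw [hderiv, norm_div, Complex.norm_real, Real.norm_eq_abs, abs_of_neg (by linarith),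
    div_le_iff₀ (by linarith)] at hbound
  calc ‖deriv G 0‖ ≤ 1 / R * -(2 * (G 0).re) := hbound
    _ = 2 * -(G 0).re / R := by ring

/-- A family of holomorphic local support functions for a domain, with uniform bounds. -/
structure SupportData (Ω : Set (E N)) (π : E N → E N) where
  /-- strictness constant -/
  c : ℝ
  /-- regularity constant -/
  K : ℝ
  /-- radius of the neighbourhoods of validity -/
  r : ℝ
  /-- diameter bound -/
  D : ℝ
  /-- support functions -/
  f : E N → E N → ℂ
  /-- linear parts of the support functions -/
  a : E N → E N →L[ℂ] ℂ
  c_pos : 0 < c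
  c_le : c ≤ 1
  K_ge : 1 ≤ K
  r_pos : 0 < r
  r_le : r ≤ 1
  D_ge : 1 ≤ D
  isOpen : IsOpen Ω
  sel : IsClosestPointSelection Ω π
  dist_le : ∀ x ∈ closure Ω, ∀ y ∈ closure Ω, ‖x - y‖ ≤ D
  diff : ∀ p ∈ frontier Ω, Differentiable ℂ (f p)
  f_self : ∀ p ∈ frontier Ω, f p p = 0
  f_lin : ∀ p ∈ frontier Ω, ∀ x y, ‖f p x - f p y - a p (x - y)‖ ≤
    K * ‖x - y‖ * (‖x - p‖ + ‖y - p‖)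
  re_le : ∀ p ∈ frontier Ω, ∀ x ∈ Ω, ‖x - p‖ < r →
    (f p x).re ≤ -(c * (‖x - p‖ ^ 2 + bdist Ω x))
  a_le : ∀ p ∈ frontier Ω, ∀ v, ‖a p v‖ ≤ K * ‖v‖
  a_lip : ∀ p ∈ frontier Ω, ∀ q ∈ frontier Ω, ∀ v, ‖a p v - a q v‖ ≤ K * ‖p - q‖ * ‖v‖
  ncomp_le : ∀ z ∈ Ω, ∀ v, ncomp Ω π z v ≤ K * ‖a (π z) v‖

namespace SupportData

variable {Ω : Set (E N)} {π : E N → E N} (S : SupportData Ω π)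

/-- The constant in the localization estimates. -/
def C : ℝ := 64 * S.D ^ 2 / (S.c * S.r ^ 4)

lemma re_neg {p : E N} (hp : p ∈ frontier Ω) {x : E N} (hx : x ∈ Ω) (hxp : ‖x - p‖ < S.r) :
    (S.f p x).re < 0 := by
  have h1 := S.re_le p hp x hx hxp
  have h2 : 0 < ‖x - p‖ := by
    rw [norm_pos_iff, sub_ne_zero]
    rintro rfl
    rw [S.isOpen.frontier_eq] at hp
    exact hp.2 hx
  have h3 : 0 ≤ bdist Ω x := infDist_nonneg
  have := mul_pos S.c_pos (show 0 < ‖x - p‖ ^ 2 + bdist Ω x by positivity)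
  linarith

open Classical in
lemma sq_norm_le {p : E N} (hp : p ∈ frontier Ω) {φ : ℂ → E N} (hφ : IsDisc Ω φ)
    (h0 : ‖φ 0 - p‖ < S.r) {b : ℂ} (hb : ‖b‖ < 1) :
    ‖φ b - p‖ ^ 2 ≤ 4 * S.D ^ 2 / (S.c * S.r ^ 2) * -(S.f p (φ 0)).re / (1 - ‖b‖) := by
  have hc := S.c_pos
  have hr := S.r_pos
  have hr1 := S.r_le
  have hD := S.D_ge
  set m := S.c * S.r ^ 2 / 4 with hm
  have hm0 : 0 < m := by positivity
  set c' := S.c * S.r ^ 2 / (4 * S.D ^ 2) with hc'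
  have hc'0 : 0 < c' := by positivity
  have hD0 : 0 < S.D := by linarith
  have hcc' : c' ≤ S.c := by
    rw [hc', div_le_iff₀ (by positivity)]
    apply mul_le_mul_of_nonneg_left _ hc.le
    nlinarith
  set w : ℂ → ℝ := fun ζ =>
    if ‖φ ζ - p‖ < S.r then min (-(S.f p (φ ζ)).re) m else m with hw
  have hwm : ∀ ζ, w ζ ≤ m := by
    intro ζ; simp only [hw]; split_ifs
    · exact min_le_right _ _
    · exact le_rfl
  have hfar : ∀ ζ ∈ ball (0:ℂ) 1, S.r / 2 ≤ ‖φ ζ - p‖ → w ζ = m := by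
    intro ζ hζ h
    simp only [hw]; split_ifs with h1
    · apply min_eq_right
      have h2 := S.re_le p hp _ (hφ.2 hζ) h1
      have h3 : 0 ≤ bdist Ω (φ ζ) := infDist_nonneg
      have h4 : (S.r / 2) ^ 2 ≤ ‖φ ζ - p‖ ^ 2 := by gcongr
      have : S.c * (S.r / 2) ^ 2 ≤ S.c * (‖φ ζ - p‖ ^ 2 + bdist Ω (φ ζ)) := by
        gcongr; linarith
      rw [hm]; nlinarith
    · rfl
  have hlow : ∀ ζ ∈ ball (0:ℂ) 1, c' * ‖φ ζ - p‖ ^ 2 ≤ w ζ := by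
    intro ζ hζ
    have h5 : c' * ‖φ ζ - p‖ ^ 2 ≤ m := by
      have h6 := S.dist_le _ (subset_closure (hφ.2 hζ)) _ (frontier_subset_closure hp)
      calc c' * ‖φ ζ - p‖ ^ 2 ≤ c' * S.D ^ 2 := by gcongr
        _ = m := by rw [hc', hm]; field_simp
    simp only [hw]; split_ifs with h1
    · apply le_min _ h5
      have h2 := S.re_le p hp _ (hφ.2 hζ) h1
      have h3 : 0 ≤ bdist Ω (φ ζ) := infDist_nonneg
      have h7 : c' * ‖φ ζ - p‖ ^ 2 ≤ S.c * ‖φ ζ - p‖ ^ 2 := by gcongr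
      nlinarith
    · exact h5
  have hφc : ∀ ζ ∈ ball (0:ℂ) 1, ContinuousAt φ ζ := fun ζ hζ =>
    (hφ.1.differentiableAt (isOpen_ball.mem_nhds hζ)).continuousAt
  have hnear : ∀ ζ ∈ ball (0:ℂ) 1, ‖φ ζ - p‖ < S.r →
      w =ᶠ[𝓝 ζ] fun ξ => min (-(S.f p (φ ξ)).re) m := by
    intro ζ hζ h
    have : ContinuousAt (fun ξ => ‖φ ξ - p‖) ζ := ((hφc ζ hζ).sub continuousAt_const).norm
    filter_upwards [this.eventually (gt_mem_nhds h)] with ξ hξ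
    simp only [hw, if_pos hξ]
  have hfd : ∀ ζ ∈ ball (0:ℂ) 1, DifferentiableAt ℂ (fun ξ => S.f p (φ ξ)) ζ := fun ζ hζ =>
    ((S.diff p hp).differentiableAt).comp ζ (hφ.1.differentiableAt (isOpen_ball.mem_nhds hζ))
  have hwc : ContinuousOn w (ball 0 1) := by
    intro ζ hζ
    apply ContinuousAt.continuousWithinAt
    by_cases h : ‖φ ζ - p‖ < S.r
    · refine ContinuousAt.congr ?_ (hnear ζ hζ h).symm
      exact (Complex.continuous_re.continuousAt.comp (hfd ζ hζ).continuousAt).neg.min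
        continuousAt_const
    · have : ContinuousAt (fun ξ => ‖φ ξ - p‖) ζ := ((hφc ζ hζ).sub continuousAt_const).norm
      have h1 : w =ᶠ[𝓝 ζ] fun _ => m := by
        filter_upwards [this.eventually (lt_mem_nhds (show S.r / 2 < ‖φ ζ - p‖ by linarith)),
          isOpen_ball.mem_nhds hζ] with ξ h1 h2
        exact hfar ξ h2 h1.le
      exact continuousAt_const.congr h1.symm
  have hwt : TouchedAbove w (ball 0 1) := by
    intro ζ hζ
    by_cases h : ‖φ ζ - p‖ < S.r ∧ -(S.f p (φ ζ)).re ≤ m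
    · refine ⟨fun ξ => -S.f p (φ ξ), ?_, ?_⟩
      · filter_upwards [hnear ζ hζ h.1, isOpen_ball.mem_nhds hζ] with ξ h1 h2
        refine ⟨(hfd ξ h2).neg, ?_⟩
        rw [h1, Complex.neg_re]
        exact min_le_left _ _
      · rw [(hnear ζ hζ h.1).eq_of_nhds, Complex.neg_re]
        exact min_eq_left h.2
    · refine ⟨fun _ => (m:ℂ), Eventually.of_forall fun ξ => ⟨differentiableAt_const _, ?_⟩, ?_⟩
      · simpa using hwm ξ
      · rw [Complex.ofReal_re]
        simp only [hw]
        split_ifs with h1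
        · exact min_eq_right (le_of_not_ge fun h2 => h ⟨h1, h2⟩)
        · rfl
  have hw0 : w 0 ≤ -(S.f p (φ 0)).re := by
    simp only [hw, if_pos h0]; exact min_le_left _ _
  have hmain : ∀ R : ℝ, ‖b‖ < R → R < 1 →
      ‖φ b - p‖ ^ 2 ≤ R / (R - ‖b‖) * (c'⁻¹ * -(S.f p (φ 0)).re) := by
    intro R hbR hR1
    have hR : 0 < R := (norm_nonneg b).trans_lt hbR
    have hcl : closedBall (0:ℂ) R ⊆ ball 0 1 := closedBall_subset_ball hR1
    have h1 := TouchedAbove.circleAverage_le hR (hwc.mono hcl)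
      (fun ζ hζ => hwt ζ (hcl (ball_subset_closedBall hζ)))
    have h2 := sq_norm_le_circleAverage (F := fun ζ => φ ζ - p) (hφ.1.sub_const p) hR hR1
      (h := fun ζ => c'⁻¹ • w ζ)
      ((hwc.mono (sphere_subset_closedBall.trans hcl)).const_smul c'⁻¹) (fun ζ hζ => by
        have := hlow ζ (hcl (sphere_subset_closedBall hζ))
        rw [smul_eq_mul, inv_mul_eq_div, le_div_iff₀ hc'0]
        linarith) hbR
    rw [Real.circleAverage_fun_smul, smul_eq_mul] at h2
    refine h2.trans ?_
    have h3 : 0 < R - ‖b‖ := by linarith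
    gcongr
    exact h1.trans hw0
  have hlim : Tendsto (fun R : ℝ => R / (R - ‖b‖) * (c'⁻¹ * -(S.f p (φ 0)).re)) (𝓝[<] 1)
      (𝓝 (1 / (1 - ‖b‖) * (c'⁻¹ * -(S.f p (φ 0)).re))) := by
    apply Tendsto.mono_left _ nhdsWithin_le_nhds
    have : ContinuousAt (fun R : ℝ => R / (R - ‖b‖) * (c'⁻¹ * -(S.f p (φ 0)).re)) 1 :=
      (ContinuousAt.div continuousAt_id (by fun_prop) (by linarith)).mul continuousAt_const
    exact this
  have hfin := ge_of_tendsto hlim (by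
    filter_upwards [Ioo_mem_nhdsLT hb] with R hR
    exact hmain R hR.1 hR.2)
  refine hfin.trans (le_of_eq ?_)
  rw [hc', inv_div]; ring

lemma C_pos : 0 < S.C := by
  have hc := S.c_pos
  have hr := S.r_pos
  have hD := S.D_ge
  unfold C; positivity

lemma sq_norm_deriv_le {p : E N} (hp : p ∈ frontier Ω) {φ : ℂ → E N} (hφ : IsDisc Ω φ)
    (h0 : ‖φ 0 - p‖ < S.r) : ‖deriv φ 0‖ ^ 2 ≤ S.C * -(S.f p (φ 0)).re := by
  have hc := S.c_pos
  have hr := S.r_pos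
  have hr1 := S.r_le
  have hD := S.D_ge
  have ht : 0 < -(S.f p (φ 0)).re := by
    linarith [S.re_neg hp (hφ.2 (by simp)) h0]
  set B := 4 * S.D ^ 2 / (S.c * S.r ^ 2) * -(S.f p (φ 0)).re with hB
  have hB0 : 0 ≤ B := by positivity
  have hsub : closure (ball (0:ℂ) (1/2)) ⊆ ball 0 1 :=
    closure_ball_subset_closedBall.trans (closedBall_subset_ball (by norm_num))
  have h1 := Complex.norm_deriv_le_of_forall_mem_sphere_norm_le (c := 0) (R := 1/2)
    (C := Real.sqrt (2 * B)) (f := fun ζ => φ ζ - p) (by norm_num)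
    (((hφ.1.sub_const p).mono hsub).diffContOnCl) (fun ζ hζ => by
      have hn : ‖ζ‖ = 1/2 := by simpa using hζ
      have := S.sq_norm_le hp hφ h0 (b := ζ) (by rw [hn]; norm_num)
      apply Real.le_sqrt_of_sq_le
      rw [hn, ← hB] at this
      norm_num at this
      linarith)
  rw [deriv_sub_const] at h1
  have h2 : ‖deriv φ 0‖ ^ 2 ≤ (Real.sqrt (2 * B) / (1/2)) ^ 2 := by gcongr
  rw [div_pow, Real.sq_sqrt (by positivity)] at h2
  refine h2.trans ?_
  have h3 : S.C * -(S.f p (φ 0)).re = 2 * B / (1/2) ^ 2 * (2 / S.r ^ 2) := by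
    rw [C, hB]; field_simp; ring
  rw [h3]
  apply le_mul_of_one_le_right (by positivity)
  rw [one_le_div (by positivity)]
  nlinarith

lemma norm_deriv_comp_le {p : E N} (hp : p ∈ frontier Ω) {φ : ℂ → E N} (hφ : IsDisc Ω φ)
    (h0 : ‖φ 0 - p‖ < S.r) (ht1 : S.C * -(S.f p (φ 0)).re < 1) :
    ‖deriv (fun ζ => S.f p (φ ζ)) 0‖ ≤
      2 * -(S.f p (φ 0)).re / (1 - S.C * -(S.f p (φ 0)).re) := by
  have hc := S.c_pos
  have hr := S.r_pos
  have hr1 := S.r_le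
  have hD := S.D_ge
  set t := -(S.f p (φ 0)).re with ht
  have ht0 : 0 < t := by
    linarith [S.re_neg hp (hφ.2 (by simp)) h0]
  have hsub : ball (0:ℂ) (1 - S.C * t) ⊆ ball 0 1 :=
    ball_subset_ball (by nlinarith [mul_pos S.C_pos ht0])
  refine norm_deriv_le_of_re_neg (by linarith)
    ((S.diff p hp).comp_differentiableOn (hφ.1.mono hsub)) fun ζ hζ => ?_
  refine S.re_neg hp (hφ.2 (hsub hζ)) ?_
  have hn : ‖ζ‖ < 1 - S.C * t := by simpa using hζ
  have h1 := S.sq_norm_le hp hφ h0 (b := ζ) (by simpa using hsub hζ)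
  have h2 : 0 < S.C * t := mul_pos S.C_pos ht0
  rw [← ht] at h1
  have h3 : ‖φ ζ - p‖ ^ 2 < S.r ^ 2 := by
    refine h1.trans_lt ?_
    rw [div_lt_iff₀ (by linarith)]
    calc 4 * S.D ^ 2 / (S.c * S.r ^ 2) * t < S.r ^ 2 * (S.C * t) := by
          rw [C]
          have : S.r ^ 2 * (64 * S.D ^ 2 / (S.c * S.r ^ 4) * t) =
            16 * (4 * S.D ^ 2 / (S.c * S.r ^ 2) * t) := by field_simp; norm_num
          rw [this]
          have : 0 < 4 * S.D ^ 2 / (S.c * S.r ^ 2) * t := by positivity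
          linarith
      _ ≤ _ := by gcongr; linarith
  exact lt_of_pow_lt_pow_left₀ 2 hr.le h3

end SupportData

/-- `u` has slope at most `m` at the origin. -/
def SlopeLE (u : ℂ → ℝ) (m : ℝ) : Prop :=
  ∀ ε > 0, ∀ᶠ ζ in 𝓝 (0:ℂ), |u ζ - u 0| ≤ (m + ε) * ‖ζ‖

lemma SlopeLE.mono {u : ℂ → ℝ} {m n : ℝ} (h : SlopeLE u m) (hmn : m ≤ n) : SlopeLE u n := by
  intro ε hε
  filter_upwards [h ε hε] with ζ hζ
  exact hζ.trans (by gcongr)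

lemma SlopeLE.congr {u v : ℂ → ℝ} {m : ℝ} (h : SlopeLE u m) (huv : u =ᶠ[𝓝 0] v) :
    SlopeLE v m := by
  intro ε hε
  filter_upwards [h ε hε, huv] with ζ hζ h1
  rwa [← h1, ← huv.eq_of_nhds]

lemma slopeLE_const (a : ℝ) : SlopeLE (fun _ => a) 0 := by
  intro ε hε
  filter_upwards with ζ
  simp; positivity

lemma SlopeLE.of_abs_sub_le {u v : ℂ → ℝ} {m : ℝ} (h : SlopeLE u m)
    (huv : ∀ᶠ ζ in 𝓝 0, |v ζ - v 0| ≤ |u ζ - u 0|) : SlopeLE v m := by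
  intro ε hε
  filter_upwards [h ε hε, huv] with ζ hζ h1 using h1.trans hζ

lemma SlopeLE.add {u v : ℂ → ℝ} {m n : ℝ} (h : SlopeLE u m) (h' : SlopeLE v n) :
    SlopeLE (fun ζ => u ζ + v ζ) (m + n) := by
  intro ε hε
  filter_upwards [h (ε / 2) (by positivity), h' (ε / 2) (by positivity)] with ζ h1 h2
  calc |u ζ + v ζ - (u 0 + v 0)| = |(u ζ - u 0) + (v ζ - v 0)| := by ring_nf
    _ ≤ |u ζ - u 0| + |v ζ - v 0| := abs_add_le _ _
    _ ≤ (m + ε / 2) * ‖ζ‖ + (n + ε / 2) * ‖ζ‖ := add_le_add h1 h2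
    _ = _ := by ring

lemma SlopeLE.const_mul {u : ℂ → ℝ} {m : ℝ} (h : SlopeLE u m) {k : ℝ} (hk : 0 < k) :
    SlopeLE (fun ζ => k * u ζ) (k * m) := by
  intro ε hε
  filter_upwards [h (ε / k) (by positivity)] with ζ h1
  rw [← mul_sub, abs_mul, abs_of_pos hk]
  calc k * |u ζ - u 0| ≤ k * ((m + ε / k) * ‖ζ‖) := by gcongr
    _ = _ := by field_simp

lemma SlopeLE.min_const {u : ℂ → ℝ} {m : ℝ} (h : SlopeLE u m) (a : ℝ) :
    SlopeLE (fun ζ => min (u ζ) a) m :=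
  h.of_abs_sub_le (Eventually.of_forall fun ζ => by
    have := abs_min_sub_min_le_max (u ζ) a (u 0) a
    simpa using this)

lemma SlopeLE.tendsto {u : ℂ → ℝ} {m : ℝ} (h : SlopeLE u m) : Tendsto u (𝓝 0) (𝓝 (u 0)) := by
  rw [tendsto_iff_norm_sub_tendsto_zero]
  refine squeeze_zero' (Eventually.of_forall fun _ => norm_nonneg _) (h 1 one_pos) ?_
  have : Continuous fun ζ : ℂ => (m + 1) * ‖ζ‖ := by fun_prop
  simpa using this.tendsto 0

lemma SlopeLE.comp {u : ℂ → ℝ} {m d : ℝ} {A : ℝ → ℝ} (h : SlopeLE u m) (hm : 0 ≤ m)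
    (hA : HasDerivAt A d (u 0)) (hd : 0 ≤ d) : SlopeLE (fun ζ => A (u ζ)) (d * m) := by
  intro ε hε
  set η := min 1 (ε / (d + m + 1)) with hη
  have hη0 : 0 < η := by positivity
  have hη1 : η ≤ 1 := min_le_left _ _
  have hη2 : η * (d + m + 1) ≤ ε := by
    rw [← le_div_iff₀ (by positivity)]; exact min_le_right _ _
  have h1 := (hasDerivAt_iff_isLittleO.1 hA).def hη0
  filter_upwards [h η hη0, h.tendsto.eventually h1] with ζ h2 h3
  have h4 : |A (u ζ) - A (u 0)| ≤ (d + η) * |u ζ - u 0| := by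
    simp only [Real.norm_eq_abs, smul_eq_mul] at h3
    have h5 := abs_sub_abs_le_abs_sub (A (u ζ) - A (u 0)) ((u ζ - u 0) * d)
    rw [abs_mul, abs_of_nonneg hd] at h5
    nlinarith
  calc |A (u ζ) - A (u 0)| ≤ (d + η) * |u ζ - u 0| := h4
    _ ≤ (d + η) * ((m + η) * ‖ζ‖) := by gcongr
    _ = ((d + η) * (m + η)) * ‖ζ‖ := by ring
    _ ≤ (d * m + ε) * ‖ζ‖ := by
      gcongr
      nlinarith

lemma slopeLE_norm_sub {F : Type*} [NormedAddCommGroup F] [NormedSpace ℂ F] {g : ℂ → F}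
    (hg : DifferentiableAt ℂ g 0) (a : F) : SlopeLE (fun ζ => ‖g ζ - a‖) ‖deriv g 0‖ := by
  intro ε hε
  filter_upwards [(hasDerivAt_iff_isLittleO.1 hg.hasDerivAt).def hε] with ζ h
  rw [sub_zero] at h
  calc |‖g ζ - a‖ - ‖g 0 - a‖| ≤ ‖(g ζ - a) - (g 0 - a)‖ := abs_norm_sub_norm_le _ _
    _ = ‖(g ζ - g 0 - ζ • deriv g 0) + ζ • deriv g 0‖ := by congr 1; abel
    _ ≤ ε * ‖ζ‖ + ‖ζ‖ * ‖deriv g 0‖ := (norm_add_le _ _).trans (by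
        rw [norm_smul]; gcongr)
    _ = _ := by ring

namespace SupportData

variable {Ω : Set (E N)} {π : E N → E N} (S : SupportData Ω π)

/-- The constant in the bound `‖f (π z) z‖ ≤ K₁ * δ z`. -/
def K₁ : ℝ := S.K * (1 + S.D)

/-- Size of the values of the support functions which are under control. -/
def ε₀ : ℝ := min (1 / (4 * S.C)) (S.c * S.r ^ 2 / 8)

/-- Points closer than `δ₀` to the boundary are handled by the support functions. -/
def δ₀ : ℝ := S.ε₀ / (2 * S.K₁)

/-- Truncated modulus of the support function at `π z`, normalized to vanish at `z`. -/
def q (z : E N) (s : ℝ) (x : E N) : ℝ :=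
  open Classical in if ‖x - π z‖ < S.r then min ‖S.f (π z) x - S.f (π z) z‖ s else s

/-- The region where `q z s` is not truncated. -/
def Near (z : E N) (s : ℝ) (x : E N) : Prop :=
  ‖x - π z‖ < S.r ∧ ‖S.f (π z) x - S.f (π z) z‖ ≤ s

lemma K₁_ge : 2 ≤ S.K₁ := by
  have := S.K_ge
  have := S.D_ge
  unfold K₁; nlinarith

lemma ε₀_pos : 0 < S.ε₀ := by
  have := S.C_pos
  have := S.c_pos
  have := S.r_pos
  unfold ε₀; positivity

lemma δ₀_pos : 0 < S.δ₀ := by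
  have := S.ε₀_pos
  have := S.K₁_ge
  unfold δ₀; positivity

lemma K₁_mul_δ₀ : S.K₁ * S.δ₀ = S.ε₀ / 2 := by
  have := S.K₁_ge
  unfold δ₀; field_simp

lemma C_mul_ε₀ : S.C * S.ε₀ ≤ 1 / 4 := by
  have h := S.C_pos
  calc S.C * S.ε₀ ≤ S.C * (1 / (4 * S.C)) := by
        gcongr; exact min_le_left _ _
    _ = 1 / 4 := by field_simp

lemma ε₀_le : S.ε₀ ≤ S.c * S.r ^ 2 / 8 := min_le_right _ _

lemma δ₀_le : S.δ₀ ≤ S.ε₀ / 2 := by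
  have h1 := S.K₁_mul_δ₀
  have h2 := S.K₁_ge
  have h3 := S.δ₀_pos
  nlinarith

lemma ε₀_le_r : S.ε₀ ≤ S.r / 8 := by
  have h := S.ε₀_le
  have := S.c_le
  have := S.r_le
  have := S.r_pos
  have := S.c_pos
  have : S.c * S.r ^ 2 ≤ S.r := by nlinarith
  linarith

lemma δ₀_lt_r : S.δ₀ < S.r := by
  have := S.ε₀_le_r
  have := S.δ₀_le
  have := S.r_pos
  linarith

lemma δ₀_le_one : S.δ₀ ≤ 1 := by
  linarith [S.δ₀_lt_r, S.r_le]

lemma mem_frontier (S : SupportData Ω π) {z : E N} (hz : z ∈ Ω) : π z ∈ frontier Ω :=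
  (S.sel z hz).1

lemma norm_sub_proj (S : SupportData Ω π) {z : E N} (hz : z ∈ Ω) : ‖z - π z‖ = bdist Ω z := by
  rw [← dist_eq_norm]; exact (S.sel z hz).2

lemma bdist_pos (S : SupportData Ω π) {z : E N} (hz : z ∈ Ω) : 0 < bdist Ω z := by
  rw [← S.norm_sub_proj hz, norm_pos_iff, sub_ne_zero]
  intro h
  have h1 := S.mem_frontier hz
  rw [← h, S.isOpen.frontier_eq] at h1
  exact h1.2 hz

lemma bdist_le {z : E N} (hz : z ∈ Ω) : bdist Ω z ≤ S.D := by
  rw [← S.norm_sub_proj hz]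
  exact S.dist_le _ (subset_closure hz) _ (frontier_subset_closure (S.mem_frontier hz))

lemma norm_f_le {z : E N} (hz : z ∈ Ω) : ‖S.f (π z) z‖ ≤ S.K₁ * bdist Ω z := by
  have hp := S.mem_frontier hz
  have h1 := S.f_lin _ hp z (π z)
  have h2 := S.a_le _ hp (z - π z)
  rw [S.f_self _ hp, sub_zero, sub_self, norm_zero, add_zero, S.norm_sub_proj hz] at h1
  rw [S.norm_sub_proj hz] at h2
  have h3 := S.bdist_pos hz
  have h4 := S.bdist_le hz
  have hK := S.K_ge
  have h5 : ‖S.f (π z) z‖ ≤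
      ‖S.f (π z) z - S.a (π z) (z - π z)‖ + ‖S.a (π z) (z - π z)‖ := by
    simpa using norm_add_le (S.f (π z) z - S.a (π z) (z - π z)) (S.a (π z) (z - π z))
  have h6 : S.K * bdist Ω z * bdist Ω z ≤ S.K * bdist Ω z * S.D := by gcongr
  unfold K₁
  nlinarith

lemma norm_f_le_add {z : E N} (hz : z ∈ Ω) (x : E N) :
    ‖S.f (π z) x‖ ≤ S.K₁ * bdist Ω z + ‖S.f (π z) x - S.f (π z) z‖ := by
  have h1 := S.norm_f_le hz
  have h2 := norm_add_le (S.f (π z) x - S.f (π z) z) (S.f (π z) z)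
  rw [sub_add_cancel] at h2
  linarith

lemma Near.lt_half {S : SupportData Ω π} {z : E N} (hz : z ∈ Ω) (hδ : bdist Ω z ≤ S.δ₀) {s : ℝ}
    (hs : s ≤ S.ε₀ / 2) {x : E N} (hx : x ∈ Ω) (h : S.Near z s x) : ‖x - π z‖ < S.r / 2 := by
  have h1 := S.re_le _ (S.mem_frontier hz) x hx h.1
  have h2 := S.norm_f_le_add hz x
  have h3 := h.2
  have h4 : S.K₁ * bdist Ω z ≤ S.ε₀ / 2 := by
    rw [← S.K₁_mul_δ₀]
    have := S.K₁_ge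
    gcongr
  have h5 := (abs_le.1 (Complex.abs_re_le_norm (S.f (π z) x))).1
  have h6 := S.ε₀_le
  have h7 := S.bdist_pos hx
  have hc := S.c_pos
  have hr := S.r_pos
  have h8 : S.c * ‖x - π z‖ ^ 2 ≤ S.c * (S.r ^ 2 / 8) := by nlinarith
  have h9 := le_of_mul_le_mul_left h8 hc
  apply lt_of_pow_lt_pow_left₀ 2 (by positivity)
  nlinarith

lemma near_self {z : E N} (hz : z ∈ Ω) (hδ : bdist Ω z ≤ S.δ₀) {s : ℝ} (hs : 0 ≤ s) :
    S.Near z s z := by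
  refine ⟨?_, by simpa⟩
  rw [S.norm_sub_proj hz]
  exact hδ.trans_lt S.δ₀_lt_r

lemma q_of_near {z : E N} {s : ℝ} {x : E N} (h : S.Near z s x) :
    S.q z s x = ‖S.f (π z) x - S.f (π z) z‖ := by
  rw [q, if_pos h.1, min_eq_left h.2]

lemma q_of_not_near {z : E N} {s : ℝ} {x : E N} (h : ¬ S.Near z s x) : S.q z s x = s := by
  rw [q]
  split_ifs with h1
  · exact min_eq_right (le_of_not_ge fun h2 => h ⟨h1, h2⟩)
  · rfl

lemma q_self {z : E N} (hz : z ∈ Ω) (hδ : bdist Ω z ≤ S.δ₀) {s : ℝ} (hs : 0 ≤ s) :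
    S.q z s z = 0 := by
  rw [S.q_of_near (S.near_self hz hδ hs)]; simp

lemma q_nonneg {z : E N} {s : ℝ} (hs : 0 ≤ s) (x : E N) : 0 ≤ S.q z s x := by
  by_cases h : S.Near z s x
  · rw [S.q_of_near h]; positivity
  · rwa [S.q_of_not_near h]

lemma q_le {z : E N} {s : ℝ} (x : E N) : S.q z s x ≤ s := by
  by_cases h : S.Near z s x
  · rw [S.q_of_near h]; exact h.2
  · rw [S.q_of_not_near h]

lemma eventually_q_eq {z : E N} (hz : z ∈ Ω) (hδ : bdist Ω z ≤ S.δ₀) {s : ℝ}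
    (hs : s ≤ S.ε₀ / 2) {φ : ℂ → E N} (hφ : IsDisc Ω φ) (h : ¬ S.Near z s (φ 0)) :
    ∀ᶠ ζ in 𝓝 (0:ℂ), S.q z s (φ ζ) = s := by
  have h0 : (0:ℂ) ∈ ball (0:ℂ) 1 := by simp
  have hc : ContinuousAt φ 0 := (hφ.1.differentiableAt (isOpen_ball.mem_nhds h0)).continuousAt
  have hn : ContinuousAt (fun ζ => ‖φ ζ - π z‖) 0 := (hc.sub continuousAt_const).norm
  by_cases h1 : ‖φ 0 - π z‖ < S.r
  · have h2 : s < ‖S.f (π z) (φ 0) - S.f (π z) z‖ := lt_of_not_ge fun h2 => h ⟨h1, h2⟩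
    have hf : ContinuousAt (fun ζ => ‖S.f (π z) (φ ζ) - S.f (π z) z‖) 0 :=
      (((S.diff _ (S.mem_frontier hz)).continuous.continuousAt.comp hc).sub
        continuousAt_const).norm
    filter_upwards [hf.eventually (lt_mem_nhds h2)] with ζ hζ
    exact S.q_of_not_near fun hN => absurd hN.2 (not_le.2 hζ)
  · have h2 : S.r / 2 < ‖φ 0 - π z‖ := by linarith [S.r_pos]
    filter_upwards [hn.eventually (lt_mem_nhds h2), isOpen_ball.mem_nhds h0] with ζ hζ hζ1
    exact S.q_of_not_near fun hN => absurd (hN.lt_half hz hδ hs (hφ.2 hζ1)) (not_lt.2 hζ.le)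

/-- Bound on the slope of `q z s` along discs. -/
def M (z : E N) (y : ℝ) : ℝ :=
  2 * (S.K₁ * bdist Ω z + y) / (1 - S.C * (S.K₁ * bdist Ω z + y))

lemma C_mul_le {z : E N} (hδ : bdist Ω z ≤ S.δ₀) {y : ℝ}
    (hy : y ≤ S.ε₀ / 2) : S.C * (S.K₁ * bdist Ω z + y) ≤ 1 / 4 := by
  have h1 : S.K₁ * bdist Ω z ≤ S.ε₀ / 2 := by
    rw [← S.K₁_mul_δ₀]
    have := S.K₁_ge
    gcongr
  calc S.C * (S.K₁ * bdist Ω z + y) ≤ S.C * S.ε₀ := by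
        have := S.C_pos
        gcongr; linarith
    _ ≤ 1 / 4 := S.C_mul_ε₀

lemma M_pos {z : E N} (hz : z ∈ Ω) (hδ : bdist Ω z ≤ S.δ₀) {y : ℝ} (hy0 : 0 ≤ y)
    (hy : y ≤ S.ε₀ / 2) : 0 < S.M z y := by
  have h1 := S.C_mul_le hδ hy
  have h2 := S.bdist_pos hz
  have h3 := S.K₁_ge
  have h4 := mul_pos (show 0 < S.K₁ by linarith) h2
  exact div_pos (by linarith) (by linarith)

lemma neg_re_le_of_near {z : E N} (hz : z ∈ Ω) {s : ℝ} {x : E N} (h : S.Near z s x) :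
    -(S.f (π z) x).re ≤ S.K₁ * bdist Ω z + S.q z s x := by
  rw [S.q_of_near h]
  have h1 := (abs_le.1 (Complex.abs_re_le_norm (S.f (π z) x))).1
  have h2 := S.norm_f_le_add hz x
  linarith

lemma slopeLE_q {z : E N} (hz : z ∈ Ω) (hδ : bdist Ω z ≤ S.δ₀) {s : ℝ} (hs0 : 0 < s)
    (hs : s ≤ S.ε₀ / 2) {φ : ℂ → E N} (hφ : IsDisc Ω φ) :
    SlopeLE (fun ζ => S.q z s (φ ζ)) (S.M z (S.q z s (φ 0))) := by
  have hq0 := S.q_nonneg (z := z) hs0.le (φ 0)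
  have hqs := (S.q_le (z := z) (s := s) (φ 0)).trans hs
  have hM := S.M_pos hz hδ hq0 hqs
  by_cases h : S.Near z s (φ 0)
  · have h0 : (0:ℂ) ∈ ball (0:ℂ) 1 := by simp
    have hd := hφ.1.differentiableAt (isOpen_ball.mem_nhds h0)
    have hfd : DifferentiableAt ℂ (fun ζ => S.f (π z) (φ ζ)) 0 :=
      ((S.diff _ (S.mem_frontier hz)).differentiableAt).comp 0 hd
    have h1 := (slopeLE_norm_sub hfd (S.f (π z) z)).min_const s
    have hCT := S.C_mul_le hδ hqs
    have ht := S.neg_re_le_of_near hz h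
    have hC := S.C_pos
    have htC : S.C * -(S.f (π z) (φ 0)).re ≤ S.C * (S.K₁ * bdist Ω z + S.q z s (φ 0)) := by
      gcongr
    have h2 := S.norm_deriv_comp_le (S.mem_frontier hz) hφ h.1 (by linarith)
    have hpos := S.re_neg (S.mem_frontier hz) (hφ.2 h0) h.1
    refine (h1.mono (h2.trans ?_)).congr ?_
    · rw [M]
      apply div_le_div₀ <;> linarith
    · have hn : ContinuousAt (fun ζ => ‖φ ζ - π z‖) 0 :=
        (hd.continuousAt.sub continuousAt_const).norm
      filter_upwards [hn.eventually (gt_mem_nhds h.1)] with ζ hζ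
      rw [q, if_pos hζ]
  · have h1 := S.eventually_q_eq hz hδ hs hφ h
    refine ((slopeLE_const s).mono hM.le).congr ?_
    filter_upwards [h1] with ζ hζ using hζ.symm

/-- The primitive of `1 / M z` vanishing at `0`. -/
def A (z : E N) (y : ℝ) : ℝ := Real.log (1 + y / (S.K₁ * bdist Ω z)) / 2 - S.C * y / 2

lemma hasDerivAt_A {z : E N} (hz : z ∈ Ω) {y : ℝ} (hy0 : 0 ≤ y) :
    HasDerivAt (S.A z) (S.M z y)⁻¹ y := by
  have h2 := S.bdist_pos hz
  have h3 := S.K₁_ge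
  have h4 : 0 < S.K₁ * bdist Ω z := mul_pos (by linarith) h2
  have h5 : 0 < 1 + y / (S.K₁ * bdist Ω z) := by positivity
  have h6 := ((((hasDerivAt_id y).div_const (S.K₁ * bdist Ω z)).const_add 1).log h5.ne').div_const 2
  have h7 := (((hasDerivAt_id y).const_mul S.C).div_const 2)
  refine (h6.sub h7).congr_deriv ?_
  rw [M, inv_div]
  have : S.K₁ * bdist Ω z + y ≠ 0 := by positivity
  simp only [id]
  field_simp

lemma A_zero (z : E N) : S.A z 0 = 0 := by simp [A]

lemma le_A {z : E N} (hz : z ∈ Ω) (hδ : bdist Ω z ≤ S.δ₀) {y : ℝ} (hy0 : 0 ≤ y)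
    (hy : y ≤ S.ε₀ / 2) : Real.log (1 + y / (2 * S.K₁ * bdist Ω z)) / 2 ≤ S.A z y := by
  have h1 := S.C_mul_le hδ hy
  have h2 := S.bdist_pos hz
  have h3 := S.K₁_ge
  set B := S.K₁ * bdist Ω z with hB
  have h4 : 0 < B := mul_pos (by linarith) h2
  have hC := S.C_pos
  rw [A, ← hB, show 2 * S.K₁ * bdist Ω z = 2 * B by rw [hB]; ring]
  have e1 : 1 + y / B = (B + y) / B := by field_simp
  have e2 : 1 + y / (2 * B) = (2 * B + y) / (2 * B) := by field_simp
  have h5 : Real.log (1 + y / (2 * B)) = Real.log (1 + y / B) +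
      Real.log ((2 * B + y) / (2 * (B + y))) := by
    rw [← Real.log_mul (by positivity) (by positivity), e1, e2]
    congr 1; field_simp
  have h6 := Real.log_le_sub_one_of_pos (show 0 < (2 * B + y) / (2 * (B + y)) by positivity)
  have h7 : (2 * B + y) / (2 * (B + y)) - 1 ≤ -(S.C * y) := by
    rw [div_sub_one (by positivity), div_le_iff₀ (by positivity)]
    nlinarith
  linarith

lemma slopeLE_A_q {z : E N} (hz : z ∈ Ω) (hδ : bdist Ω z ≤ S.δ₀) {s : ℝ} (hs0 : 0 < s)
    (hs : s ≤ S.ε₀ / 2) {φ : ℂ → E N} (hφ : IsDisc Ω φ) :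
    SlopeLE (fun ζ => S.A z (S.q z s (φ ζ))) 1 := by
  have hq0 := S.q_nonneg (z := z) hs0.le (φ 0)
  have hM := S.M_pos hz hδ hq0 ((S.q_le (φ 0)).trans hs)
  have h := (S.slopeLE_q hz hδ hs0 hs hφ).comp hM.le (S.hasDerivAt_A hz hq0) (by positivity)
  rwa [inv_mul_cancel₀ hM.ne'] at h

end SupportData

lemma SlopeLE.neg {u : ℂ → ℝ} {m : ℝ} (h : SlopeLE u m) : SlopeLE (fun ζ => -u ζ) m :=
  h.of_abs_sub_le (Eventually.of_forall fun ζ => by rw [neg_sub_neg, abs_sub_comm])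

namespace SupportData

variable {Ω : Set (E N)} {π : E N → E N} (S : SupportData Ω π)

lemma discLipschitz_A_q {z : E N} (hz : z ∈ Ω) (hδ : bdist Ω z ≤ S.δ₀) {s : ℝ} (hs0 : 0 < s)
    (hs : s ≤ S.ε₀ / 2) : DiscLipschitz Ω (fun x => S.A z (S.q z s x)) :=
  fun _ hφ => S.slopeLE_A_q hz hδ hs0 hs hφ

lemma log_le_kobayashi (hc : DiscConnected Ω) {z w : E N} (hz : z ∈ Ω) (hw : w ∈ Ω)
    (hδ : bdist Ω z ≤ S.δ₀) {s : ℝ} (hs0 : 0 < s) (hs : s ≤ S.ε₀ / 2) :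
    Real.log (1 + S.q z s w / (2 * S.K₁ * bdist Ω z)) / 2 ≤ kobayashi Ω z w ∧
      Real.log (1 + S.q z s w / (2 * S.K₁ * bdist Ω z)) / 2 ≤ kobayashi Ω w z := by
  have h := S.discLipschitz_A_q hz hδ hs0 hs
  have h1 := h.abs_sub_le_kobayashi hc hz hw
  have h2 := h.abs_sub_le_kobayashi hc hw hz
  have h3 := S.le_A hz hδ (S.q_nonneg hs0.le w) ((S.q_le (z := z) (s := s) w).trans hs)
  simp only [S.q_self hz hδ hs0.le, S.A_zero, sub_zero, zero_sub, abs_neg] at h1 h2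
  have h4 := h3.trans (le_abs_self _)
  exact ⟨h4.trans h1, h4.trans h2⟩

lemma log_one_add_div_sqrt_le {a b s : ℝ} (ha : 0 < a) (hb : 0 < b) (hs : 0 ≤ s) :
    Real.log (1 + s / (√a * √b)) ≤ Real.log (1 + s / a) / 2 + Real.log (1 + s / b) / 2 := by
  have h1 : (1 + s / (√a * √b)) ^ 2 ≤ (1 + s / a) * (1 + s / b) := by
    have ha' := Real.sq_sqrt ha.le
    have hb' := Real.sq_sqrt hb.le
    have ha0 := Real.sqrt_pos.2 ha
    have hb0 := Real.sqrt_pos.2 hb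
    rw [← ha', ← hb', Real.sqrt_sq ha0.le, Real.sqrt_sq hb0.le]
    have h2 : (1 + s / √a ^ 2) * (1 + s / √b ^ 2) - (1 + s / (√a * √b)) ^ 2 =
        s * (1 / √a - 1 / √b) ^ 2 := by
      field_simp; ring
    have h3 : 0 ≤ s * (1 / √a - 1 / √b) ^ 2 := by positivity
    linarith
  have h4 := Real.log_le_log (by positivity) h1
  rw [Real.log_pow, Real.log_mul (by positivity) (by positivity)] at h4
  push_cast at h4
  linarith

lemma log_le_kobayashi_of_disjoint (hc : DiscConnected Ω) {z w : E N} (hz : z ∈ Ω) (hw : w ∈ Ω)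
    (hδz : bdist Ω z ≤ S.δ₀) (hδw : bdist Ω w ≤ S.δ₀) {s : ℝ} (hs0 : 0 < s)
    (hs : s ≤ S.ε₀ / 2) (hdisj : ∀ x ∈ Ω, S.Near z s x → ¬ S.Near w s x) :
    Real.log (1 + s / (2 * S.K₁ * (√(bdist Ω z) * √(bdist Ω w)))) ≤ kobayashi Ω z w := by
  have h : DiscLipschitz Ω (fun x => S.A z (S.q z s x) + -S.A w (S.q w s x)) := by
    intro φ hφ
    have h0 : φ 0 ∈ Ω := hφ.2 (by simp)
    have h1 := S.slopeLE_A_q hz hδz hs0 hs hφ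
    have h2 := (S.slopeLE_A_q hw hδw hs0 hs hφ).neg
    by_cases hN : S.Near z s (φ 0)
    · have h3 := S.eventually_q_eq hw hδw hs hφ (hdisj _ h0 hN)
      have h4 : SlopeLE (fun ζ => -S.A w (S.q w s (φ ζ))) 0 :=
        (slopeLE_const (-S.A w s)).congr (by filter_upwards [h3] with ζ hζ; rw [hζ])
      exact (h1.add h4).mono (by simp)
    · have h3 := S.eventually_q_eq hz hδz hs hφ hN
      have h4 : SlopeLE (fun ζ => S.A z (S.q z s (φ ζ))) 0 :=
        (slopeLE_const (S.A z s)).congr (by filter_upwards [h3] with ζ hζ; rw [hζ])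
      exact (h4.add h2).mono (by simp)
  have h1 := h.abs_sub_le_kobayashi hc hz hw
  have hzz := S.near_self hz hδz hs0.le
  have hww := S.near_self hw hδw hs0.le
  simp only [S.q_self hz hδz hs0.le, S.q_self hw hδw hs0.le, S.A_zero,
    S.q_of_not_near (hdisj z hz hzz), S.q_of_not_near fun hN => hdisj w hw hN hww] at h1
  have h2 := S.le_A hz hδz hs0.le hs
  have h3 := S.le_A hw hδw hs0.le hs
  have hz0 := S.bdist_pos hz
  have hw0 := S.bdist_pos hw
  have hK := S.K₁_ge
  have h4 := log_one_add_div_sqrt_le hz0 hw0 (s := s / (2 * S.K₁)) (by positivity)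
  simp only [div_div] at h4
  have h5 := le_abs_self (S.A z s + -0 - (0 + -S.A w s))
  linarith

/-- The constant in the tangential estimate. -/
def T : ℝ := 4 * S.K ^ 2 * (√(S.C * (S.K₁ + 1)) + 4 * (S.K₁ + 1))

lemma T_pos : 0 < S.T := by
  have := S.K₁_ge
  have := S.K_ge
  unfold T; positivity

lemma M_le {z : E N} (hz : z ∈ Ω) (hδ : bdist Ω z ≤ S.δ₀) {y : ℝ} (hy0 : 0 ≤ y)
    (hy : y ≤ bdist Ω z) : S.M z y ≤ 4 * (S.K₁ + 1) * bdist Ω z := by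
  have h1 := S.C_mul_le hδ (hy.trans (hδ.trans S.δ₀_le))
  have h2 := S.bdist_pos hz
  have hK := S.K₁_ge
  rw [M, div_le_iff₀ (by linarith)]
  have h3 : 0 < (S.K₁ + 1) * bdist Ω z := by positivity
  nlinarith

lemma slopeLE_tangential {z : E N} (hz : z ∈ Ω) (hδ : bdist Ω z ≤ S.δ₀) {φ : ℂ → E N}
    (hφ : IsDisc Ω φ) :
    SlopeLE (fun ζ => min ((√(bdist Ω z))⁻¹ * ‖φ ζ - z‖ +
      (bdist Ω z)⁻¹ * S.q z (bdist Ω z) (φ ζ)) 1) (√(S.C * (S.K₁ + 1)) + 4 * (S.K₁ + 1)) := by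
  have h2 := S.bdist_pos hz
  have hK := S.K₁_ge
  have hC := S.C_pos
  have hδ' := hδ.trans S.δ₀_le
  have h0 : (0:ℂ) ∈ ball (0:ℂ) 1 := by simp
  have hd := hφ.1.differentiableAt (isOpen_ball.mem_nhds h0)
  by_cases hN : S.Near z (bdist Ω z) (φ 0)
  · have hq := S.q_le (z := z) (s := bdist Ω z) (φ 0)
    have hq0 := S.q_nonneg (z := z) (s := bdist Ω z) h2.le (φ 0)
    have h3 := (slopeLE_norm_sub hd z).const_mul (k := (√(bdist Ω z))⁻¹) (by positivity)
    have h4 := (S.slopeLE_q hz hδ h2 hδ' hφ).const_mul (k := (bdist Ω z)⁻¹) (by positivity)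
    refine ((h3.add h4).min_const 1).mono (add_le_add ?_ ?_)
    · rw [inv_mul_le_iff₀ (by positivity), ← Real.sqrt_mul h2.le]
      apply Real.le_sqrt_of_sq_le
      refine (S.sq_norm_deriv_le (S.mem_frontier hz) hφ hN.1).trans ?_
      have h5 := S.neg_re_le_of_near hz hN
      calc S.C * -(S.f (π z) (φ 0)).re ≤ S.C * (S.K₁ * bdist Ω z + bdist Ω z) := by
            gcongr; linarith
        _ = _ := by ring
    · rw [inv_mul_le_iff₀ h2]
      exact (S.M_le hz hδ hq0 hq).trans_eq (by ring)
  · refine ((slopeLE_const 1).mono (by positivity)).congr ?_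
    filter_upwards [S.eventually_q_eq hz hδ hδ' hφ hN] with ζ hζ
    rw [hζ, inv_mul_cancel₀ h2.ne', min_eq_right]
    have : 0 ≤ (√(bdist Ω z))⁻¹ * ‖φ ζ - z‖ := by positivity
    linarith

lemma norm_a_le {p x y : E N} (hp : p ∈ frontier Ω) : ‖S.a p (x - y)‖ ≤
    ‖S.f p x - S.f p y‖ + S.K * ‖x - y‖ * (‖x - p‖ + ‖y - p‖) := by
  have h := S.f_lin p hp x y
  have h1 := norm_sub_le (S.f p x - S.f p y) (S.f p x - S.f p y - S.a p (x - y))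
  rw [sub_sub_cancel] at h1
  linarith

lemma min_le_kobayashi (hc : DiscConnected Ω) {z w : E N} (hz : z ∈ Ω) (hw : w ∈ Ω)
    (hδ : bdist Ω z ≤ S.δ₀) :
    min 1 (ncomp Ω π z (z - w) / bdist Ω z) ≤ S.T * kobayashi Ω z w := by
  have h2 := S.bdist_pos hz
  have hK₁ := S.K₁_ge
  have hK := S.K_ge
  set m := √(S.C * (S.K₁ + 1)) + 4 * (S.K₁ + 1) with hm
  have hm0 : 0 < m := by positivity
  set μ : E N → ℝ := fun x => (√(bdist Ω z))⁻¹ * ‖x - z‖ +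
      (bdist Ω z)⁻¹ * S.q z (bdist Ω z) x with hμ
  have h : DiscLipschitz Ω (fun x => m⁻¹ * min (μ x) 1) := by
    intro φ hφ
    have h := (S.slopeLE_tangential hz hδ hφ).const_mul (k := m⁻¹) (by positivity)
    rwa [← hm, inv_mul_cancel₀ hm0.ne'] at h
  have h1 := h.abs_sub_le_kobayashi hc hz hw
  have hμz : μ z = 0 := by simp [hμ, S.q_self hz hδ h2.le]
  have hq0 := S.q_nonneg (z := z) (s := bdist Ω z) h2.le w
  have hμ0 : 0 ≤ μ w := by simp only [hμ]; positivity
  rw [hμz, min_eq_left zero_le_one, mul_zero, sub_zero, abs_of_nonneg (by positivity),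
    inv_mul_le_iff₀ hm0] at h1
  have key : min 1 (ncomp Ω π z (z - w) / bdist Ω z) ≤ 4 * S.K ^ 2 * min (μ w) 1 := by
    rcases le_or_gt 1 (μ w) with hw1 | hw1
    · rw [min_eq_right hw1]
      refine (min_le_left _ _).trans ?_
      nlinarith
    · rw [min_eq_left hw1.le]
      refine (min_le_right _ _).trans ?_
      have hN : S.Near z (bdist Ω z) w := by
        by_contra hN
        have : 1 ≤ μ w := by
          simp only [hμ]
          rw [S.q_of_not_near hN, inv_mul_cancel₀ h2.ne']
          have : 0 ≤ (√(bdist Ω z))⁻¹ * ‖w - z‖ := by positivity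
          linarith
        linarith
      have hs0 := Real.sqrt_pos.2 h2
      have hs2 := Real.sq_sqrt h2.le
      set e := √(bdist Ω z) with he
      have ha : ‖w - z‖ ≤ e * μ w := by
        have h3 : 0 ≤ (bdist Ω z)⁻¹ * S.q z (bdist Ω z) w := by positivity
        rw [← inv_mul_le_iff₀ hs0]
        simp only [hμ]; linarith
      have hb : ‖S.f (π z) w - S.f (π z) z‖ ≤ bdist Ω z * μ w := by
        rw [← inv_mul_le_iff₀ h2, ← S.q_of_near hN]
        have h3 : 0 ≤ e⁻¹ * ‖w - z‖ := by positivity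
        simp only [hμ]; linarith
      have he1 : e ≤ 1 := by
        rw [he, Real.sqrt_le_left zero_le_one, one_pow]
        exact hδ.trans S.δ₀_le_one
      have h4 := S.norm_a_le (x := z) (y := w) (S.mem_frontier hz)
      rw [norm_sub_rev z w, norm_sub_rev (S.f _ z), S.norm_sub_proj hz] at h4
      have h5 : ‖w - π z‖ ≤ ‖w - z‖ + bdist Ω z := by
        rw [← S.norm_sub_proj hz]; exact norm_sub_le_norm_sub_add_norm_sub _ _ _
      have h6 := S.ncomp_le z hz (z - w)
      rw [div_le_iff₀ h2]
      have hx : ‖w - z‖ * (bdist Ω z + ‖w - π z‖) ≤ 3 * (bdist Ω z * μ w) := by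
        calc ‖w - z‖ * (bdist Ω z + ‖w - π z‖)
            ≤ (e * μ w) * (3 * e) := by
              have : e * μ w ≤ e := by nlinarith
              have : e ^ 2 ≤ e := by nlinarith
              gcongr
              linarith
          _ = 3 * (e ^ 2 * μ w) := by ring
          _ = _ := by rw [hs2]
      have hx0 : 0 ≤ bdist Ω z * μ w := by positivity
      calc ncomp Ω π z (z - w) ≤ S.K * ‖S.a (π z) (z - w)‖ := h6
        _ ≤ S.K * (bdist Ω z * μ w + S.K * (3 * (bdist Ω z * μ w))) := by
          gcongr
          refine h4.trans ?_
          rw [mul_assoc S.K]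
          gcongr
        _ = (S.K + 3 * S.K ^ 2) * (bdist Ω z * μ w) := by ring
        _ ≤ (4 * S.K ^ 2) * (bdist Ω z * μ w) := by
          gcongr
          nlinarith
        _ = _ := by ring
  calc _ ≤ 4 * S.K ^ 2 * min (μ w) 1 := key
    _ ≤ 4 * S.K ^ 2 * (m * kobayashi Ω z w) := by gcongr
    _ = _ := by rw [T]; ring

lemma norm_sub_le_kobayashi (hc : DiscConnected Ω) {z w : E N} (hz : z ∈ Ω) (hw : w ∈ Ω) :
    ‖z - w‖ ≤ S.D * kobayashi Ω z w := by
  have hD := S.D_ge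
  have h : DiscLipschitz Ω (fun x => S.D⁻¹ * ‖x - z‖) := by
    intro φ hφ
    have h0 : (0:ℂ) ∈ ball (0:ℂ) 1 := by simp
    have hd := hφ.1.differentiableAt (isOpen_ball.mem_nhds h0)
    have h1 := (slopeLE_norm_sub hd z).const_mul (k := S.D⁻¹) (by positivity)
    refine h1.mono ?_
    rw [inv_mul_le_iff₀ (by positivity), mul_one, ← div_one S.D]
    refine Complex.norm_deriv_le_div_of_mapsTo_ball hφ.1 (fun ζ hζ => ?_) one_pos
    rw [mem_closedBall, dist_eq_norm]
    exact S.dist_le _ (subset_closure (hφ.2 hζ)) _ (subset_closure (hφ.2 h0))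
  have h1 := h.abs_sub_le_kobayashi hc hz hw
  rw [sub_self, norm_zero, mul_zero, sub_zero, abs_of_nonneg (by positivity),
    inv_mul_le_iff₀ (by positivity), norm_sub_rev] at h1
  exact h1

lemma ncomp_nonneg (z v : E N) : 0 ≤ ncomp Ω π z v :=
  div_nonneg (norm_nonneg _) infDist_nonneg

lemma sq_le_of_near {z : E N} (hz : z ∈ Ω) {s : ℝ} {x : E N} (hx : x ∈ Ω) (h : S.Near z s x) :
    ‖x - π z‖ ^ 2 ≤ (s + S.K₁ * bdist Ω z) / S.c := by
  have h1 := S.re_le _ (S.mem_frontier hz) x hx h.1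
  have h2 := S.neg_re_le_of_near hz h
  have h3 := S.q_le (z := z) (s := s) x
  have h4 := S.bdist_pos hx
  have hc := S.c_pos
  rw [le_div_iff₀ hc]
  nlinarith

/-- If the regions near `z` and `w` meet, then `z - w` has small normal component. -/
lemma norm_a_le_of_near {z w : E N} (hz : z ∈ Ω) (hw : w ∈ Ω) (hδz : bdist Ω z ≤ S.δ₀)
    (hδw : bdist Ω w ≤ S.δ₀) {s : ℝ} (hs0 : 0 < s) {x : E N} (hx : x ∈ Ω)
    (hzx : S.Near z s x) (hwx : S.Near w s x) :
    ‖S.a (π z) (z - w)‖ ≤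
      (2 + 12 * S.K * (S.K₁ / S.c + 1)) * (s + bdist Ω z + bdist Ω w) := by
  have hp := S.mem_frontier hz
  have hq := S.mem_frontier hw
  have hu := S.sq_le_of_near hz hx hzx
  have hv := S.sq_le_of_near hw hx hwx
  have hK := S.K_ge
  have hK₁ := S.K₁_ge
  have hc := S.c_pos
  have hz0 := S.bdist_pos hz
  have hw0 := S.bdist_pos hw
  have hz1 := hδz.trans S.δ₀_le_one
  have hw1 := hδw.trans S.δ₀_le_one
  have h1 := S.norm_a_le (x := z) (y := x) hp
  have h2 := S.norm_a_le (x := x) (y := w) hq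
  have h3 := S.a_lip _ hp _ hq (x - w)
  have e1 : ‖S.f (π z) z - S.f (π z) x‖ ≤ s := by rw [norm_sub_rev]; exact hzx.2
  have e2 : ‖S.f (π w) x - S.f (π w) w‖ ≤ s := hwx.2
  have e3 : ‖z - x‖ ≤ bdist Ω z + ‖x - π z‖ := by
    rw [← S.norm_sub_proj hz, norm_sub_rev x]; exact norm_sub_le_norm_sub_add_norm_sub _ _ _
  have e4 : ‖x - w‖ ≤ bdist Ω w + ‖x - π w‖ := by
    rw [← S.norm_sub_proj hw, norm_sub_rev w, add_comm]
    exact norm_sub_le_norm_sub_add_norm_sub _ _ _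
  have e5 : ‖π z - π w‖ ≤ ‖x - π z‖ + ‖x - π w‖ := by
    rw [norm_sub_rev x (π z)]; exact norm_sub_le_norm_sub_add_norm_sub _ _ _
  rw [S.norm_sub_proj hz] at h1
  rw [S.norm_sub_proj hw] at h2
  have e6 : ‖S.a (π z) (z - w)‖ ≤ ‖S.a (π z) (z - x)‖ + ‖S.a (π w) (x - w)‖ +
      ‖S.a (π z) (x - w) - S.a (π w) (x - w)‖ := by
    have : S.a (π z) (z - w) = S.a (π z) (z - x) + S.a (π w) (x - w) +
        (S.a (π z) (x - w) - S.a (π w) (x - w)) := by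
      rw [← sub_add_sub_cancel z x w, map_add]; abel
    rw [this]
    exact norm_add₃_le
  set u := ‖x - π z‖
  set v := ‖x - π w‖
  set dz := bdist Ω z
  set dw := bdist Ω w
  have hu0 : 0 ≤ u := norm_nonneg _
  have hv0 : 0 ≤ v := norm_nonneg _
  set Q := dz + dw + u + v with hQ
  have hQ2 : Q ^ 2 ≤ 4 * (u ^ 2 + v ^ 2 + dz + dw) := by
    have h5 : Q ^ 2 ≤ 4 * (u ^ 2 + v ^ 2 + dz ^ 2 + dw ^ 2) := by
      nlinarith [sq_nonneg (dz - dw), sq_nonneg (dz - u), sq_nonneg (dz - v), sq_nonneg (dw - u),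
        sq_nonneg (dw - v), sq_nonneg (u - v)]
    nlinarith
  have g1 : S.K * ‖z - x‖ * (dz + u) ≤ S.K * Q ^ 2 := by
    rw [mul_assoc, sq]
    gcongr <;> linarith
  have g2 : S.K * ‖x - w‖ * (v + dw) ≤ S.K * Q ^ 2 := by
    rw [mul_assoc, sq]
    gcongr <;> linarith
  have g3 : S.K * ‖π z - π w‖ * ‖x - w‖ ≤ S.K * Q ^ 2 := by
    rw [mul_assoc, sq]
    gcongr <;> linarith
  have g4 : u ^ 2 + v ^ 2 + dz + dw ≤ (S.K₁ / S.c + 1) * (s + dz + dw) := by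
    have : u ^ 2 + v ^ 2 ≤ S.K₁ / S.c * (s + dz + dw) := by
      calc u ^ 2 + v ^ 2 ≤ (s + S.K₁ * dz) / S.c + (s + S.K₁ * dw) / S.c := add_le_add hu hv
        _ = (2 * s + S.K₁ * dz + S.K₁ * dw) / S.c := by ring
        _ ≤ (S.K₁ * s + S.K₁ * dz + S.K₁ * dw) / S.c := by gcongr
        _ = _ := by ring
    linarith
  calc ‖S.a (π z) (z - w)‖ ≤ 2 * s + 3 * (S.K * Q ^ 2) := by linarith
    _ ≤ 2 * s + 3 * (S.K * (4 * ((S.K₁ / S.c + 1) * (s + dz + dw)))) := by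
      gcongr; exact hQ2.trans (by gcongr)
    _ ≤ _ := by linarith

lemma ncomp_le_norm (S : SupportData Ω π) {z : E N} (hz : z ∈ Ω) (v : E N) :
    ncomp Ω π z v ≤ S.K ^ 2 * ‖v‖ := by
  have h1 := S.ncomp_le z hz v
  have h2 := S.a_le _ (S.mem_frontier hz) v
  have hK := S.K_ge
  calc ncomp Ω π z v ≤ S.K * (S.K * ‖v‖) := h1.trans (by gcongr)
    _ = _ := by ring

/-- The estimate for points whose normal separation dominates the boundary distances. -/
lemma exists_log_le_of_far (S : SupportData Ω π) (hc : DiscConnected Ω) :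
    ∃ B > 0, ∃ c > 0, ∀ z ∈ Ω, ∀ w ∈ Ω,
    bdist Ω z ≤ S.δ₀ → bdist Ω w ≤ S.δ₀ → B * max (bdist Ω z) (bdist Ω w) < ncomp Ω π z (z - w) →
    Real.log (1 + c * (ncomp Ω π z (z - w) / (√(bdist Ω z) * √(bdist Ω w)))) ≤
      kobayashi Ω z w := by
  have hK := S.K_ge
  have hK₁ := S.K₁_ge
  have hc0 := S.c_pos
  have hε := S.ε₀_pos
  have hD := S.D_ge
  set C₁ := 2 + 12 * S.K * (S.K₁ / S.c + 1) with hC₁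
  have hC₁0 : 0 < C₁ := by positivity
  set σ := min (1 / (4 * C₁)) (S.ε₀ / (2 * (S.K * S.D))) with hσ
  have hσ0 : 0 < σ := by positivity
  refine ⟨S.K * (4 * C₁), by positivity, σ / (2 * S.K₁ * S.K), by positivity, ?_⟩
  intro z hz w hw hδz hδw hfar
  have hz0 := S.bdist_pos hz
  have hw0 := S.bdist_pos hw
  have hn := S.ncomp_le z hz (z - w)
  have hn1 := S.a_le _ (S.mem_frontier hz) (z - w)
  have hn2 := S.dist_le _ (subset_closure hz) _ (subset_closure hw)
  set a := ‖S.a (π z) (z - w)‖ with ha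
  have hM1 := le_max_left (bdist Ω z) (bdist Ω w)
  have hM2 := le_max_right (bdist Ω z) (bdist Ω w)
  have ha1 : 4 * C₁ * max (bdist Ω z) (bdist Ω w) < a := by
    refine lt_of_mul_lt_mul_left (a := S.K) ?_ (by linarith)
    linarith
  have ha2 : 2 * C₁ * (bdist Ω z + bdist Ω w) < a := by
    refine lt_of_le_of_lt ?_ ha1
    nlinarith
  have ha0 : 0 < a := lt_of_le_of_lt (by positivity) ha2
  have hs : σ * a ≤ S.ε₀ / 2 := by
    calc σ * a ≤ S.ε₀ / (2 * (S.K * S.D)) * (S.K * S.D) := by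
          gcongr
          · exact min_le_right _ _
          · exact hn1.trans (by gcongr)
      _ = S.ε₀ / 2 := by field_simp
  have hs1 : C₁ * (σ * a) ≤ a / 4 := by
    calc C₁ * (σ * a) ≤ C₁ * (1 / (4 * C₁) * a) := by gcongr; exact min_le_left _ _
      _ = a / 4 := by field_simp
  have h := S.log_le_kobayashi_of_disjoint hc hz hw hδz hδw (s := σ * a) (by positivity) hs ?_
  · refine le_trans (Real.log_le_log ?_ ?_) h
    · have := ncomp_nonneg (Ω := Ω) (π := π) z (z - w)
      positivity
    · gcongr 1 + ?_
      calc σ / (2 * S.K₁ * S.K) * (ncomp Ω π z (z - w) / (√(bdist Ω z) * √(bdist Ω w)))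
          ≤ σ / (2 * S.K₁ * S.K) * (S.K * a / (√(bdist Ω z) * √(bdist Ω w))) := by gcongr
        _ = _ := by field_simp
  · intro x hx hzx hwx
    have := S.norm_a_le_of_near hz hw hδz hδw (by positivity) hx hzx hwx
    rw [← hC₁, ← ha] at this
    linarith

/-- The estimate for points at very different distance from the boundary. -/
lemma exists_log_le_of_ratio (S : SupportData Ω π) (hc : DiscConnected Ω) :
    ∃ L ≥ 1, ∃ κ > 0, ∀ y ∈ Ω, ∀ x ∈ Ω,
    L * bdist Ω y ≤ bdist Ω x →
    Real.log (1 + κ * (√(bdist Ω x) / √(bdist Ω y))) ≤ kobayashi Ω y x ∧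
      Real.log (1 + κ * (√(bdist Ω x) / √(bdist Ω y))) ≤ kobayashi Ω x y := by
  have hK₁ := S.K₁_ge
  have hc0 := S.c_pos
  have hε := S.ε₀_pos
  have hδ₀ := S.δ₀_pos
  have hD := S.D_ge
  set L := 1 + 2 * S.K₁ / S.c + S.D / S.δ₀ with hL
  have hL1 : 1 ≤ L := by
    have : 0 ≤ 2 * S.K₁ / S.c + S.D / S.δ₀ := by positivity
    linarith
  have hL2 : 2 * S.K₁ ≤ L * S.c := by
    rw [← div_le_iff₀ hc0]
    have : 0 ≤ S.D / S.δ₀ := by positivity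
    linarith
  have hL3 : S.D ≤ L * S.δ₀ := by
    rw [← div_le_iff₀ hδ₀]
    have : 0 ≤ 2 * S.K₁ / S.c := by positivity
    linarith
  set c₃ := min (S.ε₀ / (2 * S.D)) (S.c / 2) with hc₃
  have hc₃0 : 0 < c₃ := by positivity
  set κ := min 1 (c₃ / (6 * S.K₁)) with hκ
  have hκ0 : 0 < κ := by positivity
  have hκ1 : κ ≤ 1 := min_le_left _ _
  refine ⟨L, hL1, κ, hκ0, ?_⟩
  intro y hy x hx hyx
  have hy0 := S.bdist_pos hy
  have hx0 := S.bdist_pos hx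
  have hxD := S.bdist_le hx
  have hyδ : bdist Ω y ≤ S.δ₀ := by
    refine le_of_mul_le_mul_left (a := L) ?_ (by linarith)
    linarith
  have h := S.log_le_kobayashi hc hy hx hyδ (s := S.ε₀ / 2) (by positivity) le_rfl
  have hq : c₃ * bdist Ω x ≤ S.q y (S.ε₀ / 2) x := by
    by_cases hN : S.Near y (S.ε₀ / 2) x
    · rw [S.q_of_near hN]
      have h1 := S.re_le _ (S.mem_frontier hy) x hx hN.1
      have h2 := S.norm_f_le hy
      have h3 := (abs_le.1 (Complex.abs_re_le_norm (S.f (π y) x))).1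
      have h4 := norm_sub_norm_le (S.f (π y) x) (S.f (π y) y)
      have h5 : 2 * S.K₁ * bdist Ω y ≤ S.c * bdist Ω x := by nlinarith
      have h6 : c₃ * bdist Ω x ≤ S.c / 2 * bdist Ω x := by gcongr; exact min_le_right _ _
      have h7 : 0 ≤ S.c * ‖x - π y‖ ^ 2 := by positivity
      linarith
    · rw [S.q_of_not_near hN]
      calc c₃ * bdist Ω x ≤ S.ε₀ / (2 * S.D) * S.D := by gcongr; exact min_le_left _ _
        _ = S.ε₀ / 2 := by field_simp
  have key : Real.log (1 + κ * (√(bdist Ω x) / √(bdist Ω y))) ≤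
      Real.log (1 + S.q y (S.ε₀ / 2) x / (2 * S.K₁ * bdist Ω y)) / 2 := by
    have hpow : Real.log ((1 + κ * (√(bdist Ω x) / √(bdist Ω y))) ^ 2) =
        Real.log (1 + κ * (√(bdist Ω x) / √(bdist Ω y))) * 2 := by
      rw [Real.log_pow, mul_comm]; norm_num
    rw [le_div_iff₀ two_pos, ← hpow]
    apply Real.log_le_log (by positivity)
    have hsy := Real.sqrt_pos.2 hy0
    have hsx := Real.sqrt_pos.2 hx0
    set b := √(bdist Ω x) / √(bdist Ω y) with hb
    have hb1 : 1 ≤ b := by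
      rw [hb, one_le_div hsy]
      apply Real.sqrt_le_sqrt
      nlinarith
    have hb2 : b ^ 2 = bdist Ω x / bdist Ω y := by
      rw [hb, div_pow, Real.sq_sqrt hx0.le, Real.sq_sqrt hy0.le]
    calc (1 + κ * b) ^ 2 ≤ 1 + 3 * κ * b ^ 2 := by
          have g1 : b ≤ b ^ 2 := by nlinarith
          have g2 : κ ^ 2 ≤ κ := by nlinarith
          have g3 : κ * b ≤ κ * b ^ 2 := by gcongr
          have g4 : κ ^ 2 * b ^ 2 ≤ κ * b ^ 2 := by gcongr
          nlinarith
      _ ≤ 1 + 3 * (c₃ / (6 * S.K₁)) * b ^ 2 := by gcongr; exact min_le_right _ _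
      _ = 1 + c₃ * bdist Ω x / (2 * S.K₁ * bdist Ω y) := by rw [hb2]; field_simp; ring
      _ ≤ _ := by gcongr
  exact ⟨key.trans h.1, key.trans h.2⟩

set_option maxHeartbeats 1000000 in
theorem exists_log_le_kobayashi (S : SupportData Ω π) (hc : DiscConnected Ω) :
    ∃ c : ℝ, 0 < c ∧ ∀ z ∈ Ω, ∀ w ∈ Ω,
    Real.log (1 + c * (ncomp Ω π z (z - w) / (√(bdist Ω z) * √(bdist Ω w)))) ≤
      kobayashi Ω z w := by
  obtain ⟨B, hB, c₁, hc₁, hfar⟩ := S.exists_log_le_of_far hc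
  obtain ⟨L, hL, κ, hκ, hratio⟩ := S.exists_log_le_of_ratio hc
  have hK := S.K_ge
  have hδ₀ := S.δ₀_pos
  have hD := S.D_ge
  have hT := S.T_pos
  have hB' : 0 < B + S.K ^ 2 * S.D / S.δ₀ := by positivity
  set B' := B + S.K ^ 2 * S.D / S.δ₀ with hB'_def
  set c₂ := κ / B' with hc₂
  set c₃ := 1 / (L * (B' * L + 1) * S.T) with hc₃
  set c₄ := S.δ₀ / (L * S.K ^ 2 * S.D) with hc₄
  refine ⟨min (min c₁ c₂) (min c₃ c₄), by positivity, ?_⟩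
  intro z hz w hw
  have hz0 := S.bdist_pos hz
  have hw0 := S.bdist_pos hw
  have hn0 := ncomp_nonneg (Ω := Ω) (π := π) z (z - w)
  have hnK := S.ncomp_le_norm hz (z - w)
  have hdist := S.dist_le _ (subset_closure hz) _ (subset_closure hw)
  set n := ncomp Ω π z (z - w) with hn
  set X := n / (√(bdist Ω z) * √(bdist Ω w)) with hX
  have hX0 : 0 ≤ X := by positivity
  have hmono : ∀ c, 0 < c → min (min c₁ c₂) (min c₃ c₄) ≤ c → Real.log (1 + c * X) ≤
      kobayashi Ω z w → Real.log (1 + min (min c₁ c₂) (min c₃ c₄) * X) ≤ kobayashi Ω z w := by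
    intro c hc0 hcc h
    refine le_trans (Real.log_le_log (by positivity) ?_) h
    gcongr
  have hlin : ∀ c, 0 < c → c * X ≤ kobayashi Ω z w → Real.log (1 + c * X) ≤ kobayashi Ω z w := by
    intro c hc0 h
    have := Real.log_le_sub_one_of_pos (show 0 < 1 + c * X by positivity)
    linarith
  by_cases hcase : bdist Ω z ≤ S.δ₀ ∧ bdist Ω w ≤ S.δ₀ ∧ B * max (bdist Ω z) (bdist Ω w) < n
  · exact hmono c₁ hc₁ ((min_le_left _ _).trans (min_le_left _ _))
      (hfar z hz w hw hcase.1 hcase.2.1 hcase.2.2)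
  have hM0 : 0 < max (bdist Ω z) (bdist Ω w) := lt_max_of_lt_left hz0
  have hnB : n ≤ B' * max (bdist Ω z) (bdist Ω w) := by
    have hlarge : S.δ₀ < max (bdist Ω z) (bdist Ω w) → n ≤ B' * max (bdist Ω z) (bdist Ω w) := by
      intro h
      calc n ≤ S.K ^ 2 * S.D := hnK.trans (by gcongr)
        _ = S.K ^ 2 * S.D / S.δ₀ * S.δ₀ := by field_simp
        _ ≤ B' * max (bdist Ω z) (bdist Ω w) := by
          gcongr
          linarith
    by_cases h1 : bdist Ω z ≤ S.δ₀
    · by_cases h2 : bdist Ω w ≤ S.δ₀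
      · have h3 : n ≤ B * max (bdist Ω z) (bdist Ω w) := not_lt.1 fun h3 => hcase ⟨h1, h2, h3⟩
        refine h3.trans ?_
        gcongr
        have : 0 ≤ S.K ^ 2 * S.D / S.δ₀ := by positivity
        linarith
      · exact hlarge (lt_max_of_lt_right (not_le.1 h2))
    · exact hlarge (lt_max_of_lt_left (not_le.1 h1))
  have hsz := Real.sqrt_pos.2 hz0
  have hsw := Real.sqrt_pos.2 hw0
  have hsz2 := Real.sq_sqrt hz0.le
  have hsw2 := Real.sq_sqrt hw0.le
  by_cases hzw : L * bdist Ω z ≤ bdist Ω w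
  · have h1 := (hratio z hz w hw hzw).1
    refine hmono c₂ (by positivity) ((min_le_left _ _).trans (min_le_right _ _)) (le_trans ?_ h1)
    apply Real.log_le_log (by positivity)
    gcongr 1 + ?_
    have hmax : max (bdist Ω z) (bdist Ω w) = √(bdist Ω w) ^ 2 := by
      rw [hsw2, max_eq_right]; nlinarith
    calc c₂ * X ≤ κ / B' * (B' * √(bdist Ω w) ^ 2 / (√(bdist Ω z) * √(bdist Ω w))) := by
          rw [← hmax, hX]; gcongr
      _ = _ := by field_simp
  by_cases hwz : L * bdist Ω w ≤ bdist Ω z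
  · have h1 := (hratio w hw z hz hwz).2
    refine hmono c₂ (by positivity) ((min_le_left _ _).trans (min_le_right _ _)) (le_trans ?_ h1)
    apply Real.log_le_log (by positivity)
    gcongr 1 + ?_
    have hmax : max (bdist Ω z) (bdist Ω w) = √(bdist Ω z) ^ 2 := by
      rw [hsz2, max_eq_left]; nlinarith
    calc c₂ * X ≤ κ / B' * (B' * √(bdist Ω z) ^ 2 / (√(bdist Ω z) * √(bdist Ω w))) := by
          rw [← hmax, hX]; gcongr
      _ = _ := by field_simp
  have hmaxL : max (bdist Ω z) (bdist Ω w) ≤ L * bdist Ω z :=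
    max_le (by nlinarith) (not_le.1 hzw).le
  have hXL : X ≤ L * (n / bdist Ω z) := by
    have h1 : bdist Ω z ≤ L * (√(bdist Ω z) * √(bdist Ω w)) := by
      have h2 : √(bdist Ω z) ≤ L * √(bdist Ω w) := by
        apply Real.sqrt_le_iff.2 ⟨by positivity, ?_⟩
        rw [mul_pow, hsw2]
        have := not_le.1 hwz
        nlinarith
      nlinarith
    rw [hX, ← mul_div_assoc, div_le_div_iff₀ (by positivity) hz0]
    nlinarith
  by_cases hzδ : bdist Ω z ≤ S.δ₀
  · refine hmono c₃ (by positivity) ((min_le_right _ _).trans (min_le_left _ _))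
      (hlin c₃ (by positivity) ?_)
    have h1 := S.min_le_kobayashi hc hz hw hzδ
    rw [← hn] at h1
    have h2 : n / bdist Ω z ≤ B' * L := by
      rw [div_le_iff₀ hz0, mul_assoc]
      exact hnB.trans (by gcongr)
    have h3 : n / bdist Ω z ≤ (B' * L + 1) * min 1 (n / bdist Ω z) := by
      have h5 : 0 ≤ n / bdist Ω z := by positivity
      have h6 : 0 < B' * L := by positivity
      rcases min_cases 1 (n / bdist Ω z) with ⟨h4, _⟩ | ⟨h4, _⟩ <;> rw [h4]
      · linarith
      · have := mul_nonneg h6.le h5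
        linarith
    calc c₃ * X ≤ c₃ * (L * ((B' * L + 1) * (S.T * kobayashi Ω z w))) := by
          gcongr
          refine hXL.trans ?_
          gcongr
          exact h3.trans (by gcongr)
      _ = kobayashi Ω z w := by rw [hc₃]; field_simp
  · refine hmono c₄ (by positivity) ((min_le_right _ _).trans (min_le_right _ _))
      (hlin c₄ (by positivity) ?_)
    have h1 := S.norm_sub_le_kobayashi hc hz hw
    calc c₄ * X ≤ c₄ * (L * (S.K ^ 2 * (S.D * kobayashi Ω z w) / S.δ₀)) := by
          gcongr
          refine hXL.trans ?_
          gcongr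
          · exact hn0.trans (hnK.trans (by gcongr))
          · exact hnK.trans (by gcongr)
          · exact (not_le.1 hzδ).le
      _ = kobayashi Ω z w := by rw [hc₄]; field_simp

end SupportData

section Complexification

variable {V : Type*} [NormedAddCommGroup V] [NormedSpace ℂ V]

/-- The `ℂ`-linear functional with real part `l`. -/
def complexify (l : V →L[ℝ] ℝ) : V →L[ℂ] ℂ := StrongDual.extendRCLike (𝕜 := ℂ) l

lemma complexify_apply (l : V →L[ℝ] ℝ) (v : V) :
    complexify l v = l v - Complex.I * l (Complex.I • v) := rfl

lemma complexify_re (l : V →L[ℝ] ℝ) (v : V) : (complexify l v).re = l v := by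
  simp [complexify_apply]

lemma complexify_im (l : V →L[ℝ] ℝ) (v : V) :
    (complexify l v).im = -l (Complex.I • v) := by
  simp [complexify_apply]

lemma norm_complexify (l : V →L[ℝ] ℝ) : ‖complexify l‖ = ‖l‖ :=
  (StrongDual.extendRCLikeₗᵢ (𝕜 := ℂ) (F := V)).norm_map l

lemma sq_norm_complexify_apply (l : V →L[ℝ] ℝ) (v : V) :
    ‖complexify l v‖ ^ 2 = l v ^ 2 + l (Complex.I • v) ^ 2 := by
  rw [Complex.sq_norm, Complex.normSq_apply, complexify_re, complexify_im]; ring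

lemma complexify_sub (l m : V →L[ℝ] ℝ) : complexify (l - m) = complexify l - complexify m := by
  ext v; simp [complexify_apply]; ring

/-- The `ℂ`-bilinear part of a real bilinear form. -/
def complexify₂ (H : V →L[ℝ] V →L[ℝ] ℝ) : V →L[ℂ] V →L[ℂ] ℂ :=
  LinearMap.mkContinuous₂
    (LinearMap.mk₂ ℂ (fun u v => (complexify (H u) v - Complex.I *
        complexify (H (Complex.I • u)) v) / 2)
      (fun u u' v => by simp [complexify_apply]; ring)
      (fun c u v => by
        have h : c • u = c.re • u + c.im • (Complex.I • u) := by
          conv_lhs => rw [← Complex.re_add_im c, add_smul, mul_smul]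
          simp
        have h' : Complex.I • c • u = c.re • (Complex.I • u) - c.im • u := by
          rw [h, smul_add, smul_comm Complex.I c.re, smul_comm Complex.I c.im, smul_smul,
            Complex.I_mul_I, neg_one_smul, smul_neg, sub_eq_add_neg]
        rw [h', h]
        apply Complex.ext <;> simp [complexify_apply] <;> ring)
      (fun u v v' => by simp only [map_add]; ring)
      (fun c u v => by simp only [map_smul, smul_eq_mul]; ring))
    ‖H‖ (fun u v => by
      have h1 : ∀ u, ‖complexify (H u) v‖ ≤ ‖H‖ * ‖u‖ * ‖v‖ := fun u => by
        refine (ContinuousLinearMap.le_opNorm _ _).trans ?_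
        rw [norm_complexify]
        gcongr
        exact H.le_opNorm u
      have h2 := h1 (Complex.I • u)
      rw [norm_smul, Complex.norm_I, one_mul] at h2
      have h3 := norm_sub_le (complexify (H u) v) (Complex.I * complexify (H (Complex.I • u)) v)
      rw [norm_mul, Complex.norm_I, one_mul] at h3
      simp only [LinearMap.mk₂_apply, norm_div, Complex.norm_ofNat]
      linarith [h1 u])

lemma complexify₂_apply_re (H : V →L[ℝ] V →L[ℝ] ℝ) (v : V) :
    (complexify₂ H v v).re = (H v v - H (Complex.I • v) (Complex.I • v)) / 2 := by
  simp only [complexify₂, LinearMap.mkContinuous₂_apply, LinearMap.mk₂_apply]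
  simp [complexify_apply]

lemma norm_complexify₂_le (H : V →L[ℝ] V →L[ℝ] ℝ) : ‖complexify₂ H‖ ≤ ‖H‖ := by
  unfold complexify₂
  exact LinearMap.mkContinuous₂_norm_le _ (norm_nonneg H) _

end Complexification

section Taylor

variable {V : Type*} [NormedAddCommGroup V] [NormedSpace ℝ V] {ρ : V → ℝ} {U : Set V}

lemma ContDiffOn.differentiableAt_fderiv (hU : IsOpen U) (hρ : ContDiffOn ℝ 2 ρ U) {x : V}
    (hx : x ∈ U) : DifferentiableAt ℝ (fderiv ℝ ρ) x :=
  ((hρ.fderiv_of_isOpen (m := 1) hU (by norm_num)).differentiableOn one_ne_zero).differentiableAt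
    (hU.mem_nhds hx)

lemma norm_fderiv_sub_le (hU : IsOpen U) (hρ : ContDiffOn ℝ 2 ρ U) {p : V} {r ε : ℝ}
    (hb : ball p r ⊆ U)
    (hH : ∀ x ∈ ball p r, ‖fderiv ℝ (fderiv ℝ ρ) x - fderiv ℝ (fderiv ℝ ρ) p‖ ≤ ε) {x : V}
    (hx : x ∈ ball p r) :
    ‖fderiv ℝ ρ x - fderiv ℝ ρ p - fderiv ℝ (fderiv ℝ ρ) p (x - p)‖ ≤ ε * ‖x - p‖ :=
  (convex_ball p r).norm_image_sub_le_of_norm_fderiv_le'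
    (fun _ hy => ContDiffOn.differentiableAt_fderiv hU hρ (hb hy)) hH
    (mem_ball_self (pos_of_mem_ball hx)) hx

lemma abs_taylor_le (hU : IsOpen U) (hρ : ContDiffOn ℝ 2 ρ U) {p : V} {r ε : ℝ}
    (hb : ball p r ⊆ U)
    (hH : ∀ x ∈ ball p r, ‖fderiv ℝ (fderiv ℝ ρ) x - fderiv ℝ (fderiv ℝ ρ) p‖ ≤ ε) {x : V}
    (hx : x ∈ ball p r) :
    |ρ x - ρ p - fderiv ℝ ρ p (x - p) - fderiv ℝ (fderiv ℝ ρ) p (x - p) (x - p) / 2| ≤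
      ε * ‖x - p‖ ^ 2 := by
  have hr := pos_of_mem_ball hx
  have hpU : p ∈ U := hb (mem_ball_self hr)
  have hε : 0 ≤ ε := by
    refine le_trans ?_ (hH x hx)
    positivity
  have hsymm : ∀ u v, fderiv ℝ (fderiv ℝ ρ) p u v = fderiv ℝ (fderiv ℝ ρ) p v u := by
    have := (hρ.contDiffAt (hU.mem_nhds hpU)).isSymmSndFDerivAt (by simp)
    exact fun u v => this u v
  set H := fderiv ℝ (fderiv ℝ ρ) p
  have hsub : closedBall p ‖x - p‖ ⊆ ball p r := by
    apply closedBall_subset_ball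
    rwa [mem_ball, dist_eq_norm] at hx
  have hd : ∀ y ∈ closedBall p ‖x - p‖, HasFDerivAt (fun y => ρ y - H (y - p) (y - p) / 2)
      (fderiv ℝ ρ y - H (y - p)) y := by
    intro y hy
    have h1 := ((hρ.differentiableOn two_ne_zero).differentiableAt
      (hU.mem_nhds (hb (hsub hy)))).hasFDerivAt
    have h2 : HasFDerivAt (fun y => y - p) (ContinuousLinearMap.id ℝ V) y :=
      (hasFDerivAt_id y).sub_const p
    have h3 := ((H.hasFDerivAt.comp y h2).clm_apply h2).const_mul (1 / 2 : ℝ)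
    refine (h1.sub (h3.congr_fderiv (f' := _) (g' := H (y - p)) ?_)).congr_of_eventuallyEq ?_
    · ext v
      simp [hsymm v]
      ring
    · filter_upwards with t
      simp; ring
  have h := (convex_closedBall p ‖x - p‖).norm_image_sub_le_of_norm_fderiv_le'
    (fun y hy => (hd y hy).differentiableAt) (φ := fderiv ℝ ρ p) (C := ε * ‖x - p‖)
    (fun y hy => by
      rw [(hd y hy).fderiv, sub_right_comm]
      refine (norm_fderiv_sub_le hU hρ hb hH (hsub hy)).trans ?_
      rw [mem_closedBall, dist_eq_norm] at hy
      gcongr) (mem_closedBall_self (norm_nonneg _)) (by simp [dist_eq_norm] : x ∈ _)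
  rw [Real.norm_eq_abs] at h
  simp only [sub_self, map_zero, zero_div, sub_zero] at h
  convert h using 1
  · congr 1; ring
  · ring

end Taylor

lemma exists_pos_le_add_mul {X : Type*} [TopologicalSpace X] [T2Space X] {s : Set X}
    (hs : IsCompact s)
    {g h : X → ℝ} (hg : ContinuousOn g s) (hh : ContinuousOn h s) (h0 : ∀ x ∈ s, 0 ≤ h x)
    (hgh : ∀ x ∈ s, h x = 0 → 0 < g x) : ∃ A ≥ 0, ∃ c > 0, ∀ x ∈ s, c ≤ g x + A * h x := by
  obtain ⟨B, hB⟩ := hs.exists_bound_of_continuousOn hg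
  have hs' : IsCompact (s ∩ g ⁻¹' Iic 0) :=
    hs.of_isClosed_subset (hg.preimage_isClosed_of_isClosed hs.isClosed isClosed_Iic)
      inter_subset_left
  obtain ⟨m, hm, hm'⟩ := hs'.exists_forall_le' (a := 0) (hh.mono fun x hx => hx.1) (by
    intro x hx
    refine lt_of_le_of_ne (h0 x hx.1) fun h => ?_
    exact absurd (hgh x hx.1 h.symm) (not_lt.2 hx.2))
  refine ⟨(|B| + 1) / m, by positivity, ?_⟩
  obtain ⟨c, hc, hcA⟩ := hs.exists_forall_le' (a := 0) (hg.add (hh.const_mul ((|B| + 1) / m))) (by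
    intro x hx
    change 0 < g x + (|B| + 1) / m * h x
    by_cases hgx : g x ≤ 0
    · have h1 := hm' x ⟨hx, hgx⟩
      have h2 := (abs_le.1 (hB x hx)).1
      have h3 : |B| + 1 ≤ (|B| + 1) / m * h x := by
        calc |B| + 1 = (|B| + 1) / m * m := by field_simp
          _ ≤ _ := by gcongr
      have := le_abs_self B
      linarith
    · have := h0 x hx
      have : 0 < g x := not_le.1 hgx
      positivity)
  exact ⟨c, hc, hcA⟩

/-- `ρ` is a `C²` defining function of the bounded strongly pseudoconvex domain `Ω` on the
neighbourhood `U` of its closure. -/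
structure IsDefiningFunction (Ω U : Set (E N)) (ρ : E N → ℝ) : Prop where
  isOpen : IsOpen Ω
  isBounded : Bornology.IsBounded Ω
  isOpen_nhd : IsOpen U
  closure_subset : closure Ω ⊆ U
  contDiffOn : ContDiffOn ℝ 2 ρ U
  eq_setOf : Ω = {x ∈ U | ρ x < 0}
  fderiv_ne_zero : ∀ p ∈ frontier Ω, fderiv ℝ ρ p ≠ 0
  levi_pos : ∀ p ∈ frontier Ω, ∀ v : E N, v ≠ 0 → complexify (fderiv ℝ ρ p) v = 0 →
    0 < levi ρ p v

lemma levi_eq (ρ : E N → ℝ) (p v : E N) :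
    levi ρ p v = (fderiv ℝ (fderiv ℝ ρ) p v v +
      fderiv ℝ (fderiv ℝ ρ) p (Complex.I • v) (Complex.I • v)) / 4 := by
  simp [levi, iteratedFDeriv_two_apply]

lemma levi_smul (ρ : E N → ℝ) (p v : E N) (t : ℝ) :
    levi ρ p ((t : ℂ) • v) = t ^ 2 * levi ρ p v := by
  rw [levi_eq, levi_eq, smul_comm Complex.I (t : ℂ) v]
  simp only [Complex.coe_smul, map_smul, _root_.smul_apply, smul_eq_mul]
  ring

lemma ball_bdist_subset {Ω : Set (E N)} (ho : IsOpen Ω) {z : E N} (hz : z ∈ Ω)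
    (h : 0 < bdist Ω z) : ball z (bdist Ω z) ⊆ Ω := by
  refine (convex_ball z (bdist Ω z)).isPreconnected.subset_of_closure_inter_subset ho
    ⟨z, mem_ball_self h, hz⟩ fun x hx => ?_
  by_contra hxΩ
  have hxf : x ∈ frontier Ω := ⟨hx.1, by rwa [ho.interior_eq]⟩
  have := Metric.infDist_le_dist_of_mem (x := z) hxf
  have h2 := mem_ball'.1 hx.2
  exact absurd h2 (not_lt.2 this)

lemma norm_herm_neg (v e : E N) : ‖herm v (-e)‖ = ‖inner ℂ e v‖ := by
  have : herm v (-e) = -inner ℂ e v := by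
    simp [herm, PiLp.inner_apply]
  rw [this, norm_neg]

/-- A real functional that is nonpositive on an open half-space is a multiple of the functional
defining it. -/
lemma complexify_eq_of_nonpos {l : E N →L[ℝ] ℝ} {e : E N} (he : e ≠ 0)
    (h : ∀ v, 0 < (inner ℂ e v).re → l v ≤ 0) (v : E N) :
    complexify l v = ((l e / ‖e‖ ^ 2 : ℝ) : ℂ) * inner ℂ e v := by
  have hee : (inner ℂ e e).re = ‖e‖ ^ 2 := by
    rw [inner_self_eq_norm_sq_to_K]; norm_cast
  have he2 : 0 < ‖e‖ ^ 2 := by positivity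
  have h0 : ∀ u, (inner ℂ e u).re = 0 → l u ≤ 0 := by
    intro u hu
    by_contra! hlu
    have := h (((|l e| + 1) / l u) • u + e) (by
      have : inner ℂ e (((|l e| + 1) / l u) • u + e) =
          (((|l e| + 1) / l u : ℝ) : ℂ) * inner ℂ e u + inner ℂ e e := by
        rw [inner_add_right, ← Complex.coe_smul, inner_smul_right]
      rw [this, Complex.add_re, Complex.re_ofReal_mul, hu, hee]
      simpa using he2)
    rw [map_add, map_smul, smul_eq_mul, div_mul_cancel₀ _ hlu.ne'] at this
    linarith [neg_abs_le (l e)]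
  have h1 : ∀ u, l u = l e / ‖e‖ ^ 2 * (inner ℂ e u).re := by
    intro u
    set s := (inner ℂ e u).re / ‖e‖ ^ 2
    have hs : (inner ℂ e (u - s • e)).re = 0 := by
      rw [inner_sub_right, ← Complex.coe_smul, inner_smul_right, Complex.sub_re,
        Complex.re_ofReal_mul, hee]
      simp only [s]; field_simp; ring
    have h2 := h0 _ hs
    have h3 := h0 (-(u - s • e)) (by rw [inner_neg_right, Complex.neg_re, hs, neg_zero])
    rw [map_neg] at h3
    have h4 : l (u - s • e) = 0 := by linarith
    rw [map_sub, map_smul, smul_eq_mul] at h4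
    have : l u = s * l e := by linarith
    rw [this]; simp only [s]; ring
  apply Complex.ext
  · rw [complexify_re, Complex.re_ofReal_mul, h1]
  · rw [complexify_im, Complex.im_ofReal_mul, h1, inner_smul_right]
    simp

namespace IsDefiningFunction

variable {Ω U : Set (E N)} {ρ : E N → ℝ}

lemma frontier_subset (h : IsDefiningFunction Ω U ρ) : frontier Ω ⊆ U :=
  frontier_subset_closure.trans h.closure_subset

lemma isCompact_frontier (h : IsDefiningFunction Ω U ρ) : IsCompact (frontier Ω) :=
  h.isBounded.isCompact_closure.of_isClosed_subset isClosed_frontier frontier_subset_closure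

lemma le_zero (h : IsDefiningFunction Ω U ρ) {p : E N} (hp : p ∈ closure Ω) : ρ p ≤ 0 := by
  refine ContinuousWithinAt.closure_le (s := Ω) (g := fun _ => 0) hp ?_
    continuousWithinAt_const fun y hy => ?_
  · exact ((h.contDiffOn.continuousOn.continuousAt
      (h.isOpen_nhd.mem_nhds (h.closure_subset hp)))).continuousWithinAt
  · rw [h.eq_setOf] at hy
    exact hy.2.le

lemma eq_zero (h : IsDefiningFunction Ω U ρ) {p : E N} (hp : p ∈ frontier Ω) : ρ p = 0 := by
  refine le_antisymm (h.le_zero (frontier_subset_closure hp)) ?_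
  by_contra! hlt
  have : p ∈ Ω := by
    rw [h.eq_setOf]
    exact ⟨h.frontier_subset hp, hlt⟩
  rw [h.isOpen.frontier_eq] at hp
  exact hp.2 this

lemma continuousOn_fderiv (h : IsDefiningFunction Ω U ρ) : ContinuousOn (fderiv ℝ ρ) U :=
  h.contDiffOn.continuousOn_fderiv_of_isOpen h.isOpen_nhd (by norm_num)

lemma continuousOn_fderiv_fderiv (h : IsDefiningFunction Ω U ρ) :
    ContinuousOn (fderiv ℝ (fderiv ℝ ρ)) U :=
  (h.contDiffOn.fderiv_of_isOpen (m := 1) h.isOpen_nhd (by norm_num)).continuousOn_fderiv_of_isOpen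
    h.isOpen_nhd le_rfl

lemma exists_levi_bound (h : IsDefiningFunction Ω U ρ) :
    ∃ A ≥ 0, ∃ c > 0, ∀ p ∈ frontier Ω, ∀ v : E N,
      c * ‖v‖ ^ 2 ≤ levi ρ p v + A * ‖complexify (fderiv ℝ ρ p) v‖ ^ 2 := by
  have hfst : MapsTo Prod.fst (frontier Ω ×ˢ sphere (0 : E N) 1) U :=
    fun x hx => h.frontier_subset hx.1
  have hl : ContinuousOn (fun x : E N × E N => fderiv ℝ ρ x.1)
      (frontier Ω ×ˢ sphere (0 : E N) 1) :=
    h.continuousOn_fderiv.comp continuousOn_fst hfst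
  have hH : ContinuousOn (fun x : E N × E N => fderiv ℝ (fderiv ℝ ρ) x.1)
      (frontier Ω ×ˢ sphere (0 : E N) 1) :=
    h.continuousOn_fderiv_fderiv.comp continuousOn_fst hfst
  obtain ⟨A, hA, c, hc, hAc⟩ := exists_pos_le_add_mul
    (h.isCompact_frontier.prod (isCompact_sphere (0 : E N) 1))
    (g := fun x => levi ρ x.1 x.2) (h := fun x => ‖complexify (fderiv ℝ ρ x.1) x.2‖ ^ 2)
    (by
      simp only [levi_eq]
      fun_prop)
    (by
      simp only [sq_norm_complexify_apply]
      fun_prop)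
    (fun x _ => by positivity)
    (fun x hx h0 => h.levi_pos x.1 hx.1 x.2 (ne_zero_of_mem_unit_sphere ⟨x.2, hx.2⟩) (by
      simpa using h0))
  refine ⟨A, hA, c, hc, fun p hp v => ?_⟩
  rcases eq_or_ne v 0 with rfl | hv
  · have := levi_smul ρ p 0 0
    simp at this
    simp [this]
  have hv' : ‖v‖ ≠ 0 := norm_ne_zero_iff.2 hv
  have := hAc (p, ((‖v‖⁻¹ : ℝ) : ℂ) • v) ⟨hp, by simp [norm_smul, hv']⟩
  simp only [levi_smul, map_smul, norm_smul, Complex.norm_real, norm_inv, norm_norm] at this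
  have h2 := mul_le_mul_of_nonneg_right this (sq_nonneg ‖v‖)
  refine h2.trans_eq ?_
  field_simp

lemma exists_bounds (h : IsDefiningFunction Ω U ρ) :
    ∃ L ≥ 1, ∃ m > 0, ∀ p ∈ frontier Ω, ‖fderiv ℝ ρ p‖ ≤ L ∧
      ‖fderiv ℝ (fderiv ℝ ρ) p‖ ≤ L ∧ m ≤ ‖fderiv ℝ ρ p‖ := by
  have hl := h.continuousOn_fderiv.mono h.frontier_subset
  obtain ⟨L₁, hL₁⟩ := h.isCompact_frontier.exists_bound_of_continuousOn hl
  obtain ⟨L₂, hL₂⟩ := h.isCompact_frontier.exists_bound_of_continuousOn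
    (f := fderiv ℝ (fderiv ℝ ρ)) (h.continuousOn_fderiv_fderiv.mono h.frontier_subset)
  obtain ⟨m, hm, hm'⟩ := h.isCompact_frontier.exists_forall_le' (a := 0) hl.norm
    fun p hp => norm_pos_iff.2 (h.fderiv_ne_zero p hp)
  exact ⟨max 1 (max L₁ L₂), le_max_left _ _, m, hm, fun p hp =>
    ⟨(hL₁ p hp).trans ((le_max_left _ _).trans (le_max_right _ _)),
      (hL₂ p hp).trans ((le_max_right _ _).trans (le_max_right _ _)), hm' p hp⟩⟩

lemma exists_radius (h : IsDefiningFunction Ω U ρ) {ε : ℝ} (hε : 0 < ε) :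
    ∃ r > 0, ∀ p ∈ frontier Ω, ball p r ⊆ U ∧ ∀ x ∈ ball p r,
      ‖fderiv ℝ (fderiv ℝ ρ) x - fderiv ℝ (fderiv ℝ ρ) p‖ ≤ ε := by
  obtain ⟨r₁, hr₁, h₁⟩ := h.isCompact_frontier.exists_thickening_subset_open h.isOpen_nhd
    h.frontier_subset
  have h₂ := h.isCompact_frontier.uniformContinuousAt_of_continuousAt (fderiv ℝ (fderiv ℝ ρ))
    (fun p hp => h.continuousOn_fderiv_fderiv.continuousAt
      (h.isOpen_nhd.mem_nhds (h.frontier_subset hp)))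
    (Metric.dist_mem_uniformity (α := E N →L[ℝ] E N →L[ℝ] ℝ) hε)
  obtain ⟨r₂, hr₂, h₂⟩ := Metric.mem_uniformity_dist.1 h₂
  refine ⟨min r₁ r₂, lt_min hr₁ hr₂, fun p hp => ⟨fun x hx => h₁ ?_, fun x hx => ?_⟩⟩
  · exact mem_thickening_iff.2 ⟨p, hp, (mem_ball.1 hx).trans_le (min_le_left _ _)⟩
  · have := h₂ ((mem_ball'.1 hx).trans_le (min_le_right _ _)) hp
    have h₃ : dist (fderiv ℝ (fderiv ℝ ρ) x) (fderiv ℝ (fderiv ℝ ρ) p) < ε := by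
      rw [dist_comm]; exact this
    exact (dist_eq_norm (fderiv ℝ (fderiv ℝ ρ) x) (fderiv ℝ (fderiv ℝ ρ) p) ▸ h₃).le

lemma bdist_pos (h : IsDefiningFunction Ω U ρ) {z p : E N} (hz : z ∈ Ω) (hp : p ∈ frontier Ω)
    (hd : dist z p = bdist Ω z) : 0 < bdist Ω z := by
  rw [← hd, dist_pos]
  rintro rfl
  rw [h.isOpen.frontier_eq] at hp
  exact hp.2 hz

lemma complexify_fderiv_eq (h : IsDefiningFunction Ω U ρ) {z p : E N} (hz : z ∈ Ω)
    (hp : p ∈ frontier Ω) (hd : dist z p = bdist Ω z) (v : E N) :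
    complexify (fderiv ℝ ρ p) v =
      ((fderiv ℝ ρ p (z - p) / ‖z - p‖ ^ 2 : ℝ) : ℂ) * inner ℂ (z - p) v := by
  have hpos := h.bdist_pos hz hp hd
  have hnorm : ‖z - p‖ = bdist Ω z := by rw [← hd, dist_eq_norm]
  refine complexify_eq_of_nonpos (norm_pos_iff.1 (hnorm ▸ hpos)) (fun v hv => ?_) v
  have hv0 : v ≠ 0 := by rintro rfl; simp at hv
  have hvn : 0 < ‖v‖ ^ 2 := by positivity
  set b := (inner ℂ (z - p) v).re
  set t := b / ‖v‖ ^ 2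
  have ht : 0 < t := by positivity
  have hsub : closedBall z (bdist Ω z) ⊆ closure Ω := by
    rw [← closure_ball z hpos.ne']
    exact closure_mono (ball_bdist_subset h.isOpen hz hpos)
  have hmem : p + t • v ∈ closedBall z (bdist Ω z) := by
    rw [mem_closedBall, dist_eq_norm, ← hnorm, ← sq_le_sq₀ (norm_nonneg _) (norm_nonneg _),
      norm_sub_rev, ← sub_sub, @norm_sub_sq ℂ, ← Complex.coe_smul, inner_smul_right]
    have h1 : RCLike.re ((t : ℂ) * inner ℂ (z - p) v) = t * b := Complex.re_ofReal_mul _ _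
    rw [h1, norm_smul, Complex.norm_real, mul_pow, Real.norm_eq_abs, sq_abs]
    have h2 : t ^ 2 * ‖v‖ ^ 2 = t * b := by simp only [t]; field_simp
    rw [h2]
    have : 0 < t * b := by positivity
    linarith
  have hmax : IsLocalMaxOn ρ (closedBall z (bdist Ω z)) p := by
    refine IsMaxOn.localize fun x hx => ?_
    rw [Set.mem_ofPred_eq, h.eq_zero hp]
    exact h.le_zero (hsub hx)
  have hρp : HasFDerivAt ρ (fderiv ℝ ρ p) p :=
    ((h.contDiffOn.differentiableOn two_ne_zero).differentiableAt
      (h.isOpen_nhd.mem_nhds (h.frontier_subset hp))).hasFDerivAt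
  have hle := hmax.hasFDerivWithinAt_nonpos hρp.hasFDerivWithinAt
    (mem_posTangentConeAt_of_segment_subset (y := t • v)
      ((convex_closedBall z (bdist Ω z)).segment_subset (by
        rw [mem_closedBall, dist_comm, hd]) hmem))
  rw [map_smul, smul_eq_mul] at hle
  exact nonpos_of_mul_nonpos_right hle ht

lemma norm_fderiv_mul_le (h : IsDefiningFunction Ω U ρ) {z p : E N} (hz : z ∈ Ω)
    (hp : p ∈ frontier Ω) (hd : dist z p = bdist Ω z) :
    ‖fderiv ℝ ρ p‖ * ‖z - p‖ ≤ |fderiv ℝ ρ p (z - p)| := by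
  have hpos : 0 < ‖z - p‖ := by
    rw [← dist_eq_norm, hd]; exact h.bdist_pos hz hp hd
  rw [← le_div_iff₀ hpos, ← norm_complexify]
  refine ContinuousLinearMap.opNorm_le_bound _ (by positivity) fun v => ?_
  rw [h.complexify_fderiv_eq hz hp hd, norm_mul, Complex.norm_real, Real.norm_eq_abs, abs_div,
    abs_of_nonneg (sq_nonneg ‖z - p‖)]
  calc |fderiv ℝ ρ p (z - p)| / ‖z - p‖ ^ 2 * ‖inner ℂ (z - p) v‖
      ≤ |fderiv ℝ ρ p (z - p)| / ‖z - p‖ ^ 2 * (‖z - p‖ * ‖v‖) := by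
        gcongr
        exact norm_inner_le_norm _ _
    _ = |fderiv ℝ ρ p (z - p)| / ‖z - p‖ * ‖v‖ := by field_simp

lemma fderiv_apply_le (h : IsDefiningFunction Ω U ρ) {z p : E N} (hz : z ∈ Ω)
    (hp : p ∈ frontier Ω) (hd : dist z p = bdist Ω z) :
    fderiv ℝ ρ p (z - p) ≤ -(‖fderiv ℝ ρ p‖ * ‖z - p‖) := by
  have hpos := h.bdist_pos hz hp hd
  have hsub : closedBall z (bdist Ω z) ⊆ closure Ω := by
    rw [← closure_ball z hpos.ne']
    exact closure_mono (ball_bdist_subset h.isOpen hz hpos)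
  have hmax : IsLocalMaxOn ρ (closedBall z (bdist Ω z)) p := by
    refine IsMaxOn.localize fun x hx => ?_
    rw [Set.mem_ofPred_eq, h.eq_zero hp]
    exact h.le_zero (hsub hx)
  have hρp : HasFDerivAt ρ (fderiv ℝ ρ p) p :=
    ((h.contDiffOn.differentiableOn two_ne_zero).differentiableAt
      (h.isOpen_nhd.mem_nhds (h.frontier_subset hp))).hasFDerivAt
  have hle := hmax.hasFDerivWithinAt_nonpos hρp.hasFDerivWithinAt
    (mem_posTangentConeAt_of_segment_subset (y := z - p)
      ((convex_closedBall z (bdist Ω z)).segment_subset (by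
        rw [mem_closedBall, dist_comm, hd]) (by simpa using hpos.le)))
  have := h.norm_fderiv_mul_le hz hp hd
  rw [abs_of_nonpos hle] at this
  linarith

lemma ncomp_mul_le (h : IsDefiningFunction Ω U ρ) {π : E N → E N}
    (hπ : IsClosestPointSelection Ω π) {z : E N} (hz : z ∈ Ω) (v : E N) :
    ‖fderiv ℝ ρ (π z)‖ * ncomp Ω π z v ≤ ‖complexify (fderiv ℝ ρ (π z)) v‖ := by
  obtain ⟨hp, hd⟩ := hπ z hz
  have hnorm : ‖z - π z‖ = bdist Ω z := by rw [← hd, dist_eq_norm]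
  have hpos : 0 < ‖z - π z‖ := hnorm ▸ h.bdist_pos hz hp hd
  rw [h.complexify_fderiv_eq hz hp hd, ncomp, ← neg_sub, norm_herm_neg, ← hnorm, norm_mul,
    Complex.norm_real, Real.norm_eq_abs, abs_div, abs_of_nonneg (sq_nonneg ‖z - π z‖)]
  calc ‖fderiv ℝ ρ (π z)‖ * (‖inner ℂ (z - π z) v‖ / ‖z - π z‖)
      = ‖fderiv ℝ ρ (π z)‖ * ‖z - π z‖ / ‖z - π z‖ ^ 2 * ‖inner ℂ (z - π z) v‖ := by
        field_simp
    _ ≤ _ := by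
        gcongr
        exact h.norm_fderiv_mul_le hz hp hd

/-- The Levi polynomial of `ρ` at `p`, corrected by a multiple of the square of its linear
part. -/
def leviPoly (ρ : E N → ℝ) (A : ℝ) (p x : E N) : ℂ :=
  complexify (fderiv ℝ ρ p) (x - p) +
    1 / 2 * complexify₂ (fderiv ℝ (fderiv ℝ ρ) p) (x - p) (x - p) +
    A * complexify (fderiv ℝ ρ p) (x - p) ^ 2

lemma differentiable_leviPoly (ρ : E N → ℝ) (A : ℝ) (p : E N) :
    Differentiable ℂ (leviPoly ρ A p) := by
  unfold leviPoly
  fun_prop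

lemma leviPoly_re (ρ : E N → ℝ) (A : ℝ) (p x : E N) :
    (leviPoly ρ A p x).re = fderiv ℝ ρ p (x - p) +
      fderiv ℝ (fderiv ℝ ρ) p (x - p) (x - p) / 2 -
      (levi ρ p (x - p) + A * ‖complexify (fderiv ℝ ρ p) (x - p)‖ ^ 2) +
      2 * A * fderiv ℝ ρ p (x - p) ^ 2 := by
  have h1 : (1 / 2 * complexify₂ (fderiv ℝ (fderiv ℝ ρ) p) (x - p) (x - p)).re =
      1 / 2 * (complexify₂ (fderiv ℝ (fderiv ℝ ρ) p) (x - p) (x - p)).re := by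
    simp
  rw [leviPoly, Complex.add_re, Complex.add_re, h1, complexify₂_apply_re, complexify_re, levi_eq,
    Complex.re_ofReal_mul, sq_norm_complexify_apply, sq (complexify _ _), Complex.mul_re,
    complexify_re, complexify_im]
  ring

lemma norm_leviPoly_sub_le {A L : ℝ} (hA : 0 ≤ A) {p : E N}
    (h1 : ‖fderiv ℝ ρ p‖ ≤ L) (h2 : ‖fderiv ℝ (fderiv ℝ ρ) p‖ ≤ L) (x y : E N) :
    ‖leviPoly ρ A p x - leviPoly ρ A p y - complexify (fderiv ℝ ρ p) (x - y)‖ ≤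
      (L + A * L ^ 2) * ‖x - y‖ * (‖x - p‖ + ‖y - p‖) := by
  have hL : 0 ≤ L := (norm_nonneg _).trans h1
  have ha : ∀ v, ‖complexify (fderiv ℝ ρ p) v‖ ≤ L * ‖v‖ := fun v =>
    (ContinuousLinearMap.le_opNorm _ v).trans (by rw [norm_complexify]; gcongr)
  have hq : ∀ v w, ‖complexify₂ (fderiv ℝ (fderiv ℝ ρ) p) v w‖ ≤ L * ‖v‖ * ‖w‖ := fun v w =>
    (ContinuousLinearMap.le_opNorm₂ _ v w).trans (by
      have := (norm_complexify₂_le (fderiv ℝ (fderiv ℝ ρ) p)).trans h2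
      gcongr)
  unfold leviPoly
  set a := complexify (fderiv ℝ ρ p)
  set q := complexify₂ (fderiv ℝ (fderiv ℝ ρ) p)
  set v := x - p
  set w := y - p
  have hu : x - y = v - w := by simp [v, w]
  rw [hu]
  have key : a v + 1 / 2 * q v v + A * a v ^ 2 - (a w + 1 / 2 * q w w + A * a w ^ 2) - a (v - w) =
      1 / 2 * (q (v - w) v + q w (v - w)) + A * (a (v - w) * (a v + a w)) := by
    simp only [map_sub, sub_apply]
    ring
  rw [key]
  have e1 : ‖(1 / 2 : ℂ) * (q (v - w) v + q w (v - w))‖ ≤ L * ‖v - w‖ * (‖v‖ + ‖w‖) := by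
    rw [norm_mul]
    have h3 := norm_add_le (q (v - w) v) (q w (v - w))
    have h4 := hq (v - w) v
    have h5 := hq w (v - w)
    have h6 : ‖(1 / 2 : ℂ)‖ = 1 / 2 := by simp
    rw [h6]
    have := norm_nonneg (q (v - w) v + q w (v - w))
    linarith
  have e2 : ‖(A : ℂ) * (a (v - w) * (a v + a w))‖ ≤
      A * L ^ 2 * ‖v - w‖ * (‖v‖ + ‖w‖) := by
    rw [norm_mul, norm_mul, Complex.norm_real, Real.norm_of_nonneg hA]
    calc A * (‖a (v - w)‖ * ‖a v + a w‖)
        ≤ A * ((L * ‖v - w‖) * (L * ‖v‖ + L * ‖w‖)) := by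
          gcongr
          · exact ha _
          · exact (norm_add_le _ _).trans (add_le_add (ha v) (ha w))
      _ = _ := by ring
  have := norm_add_le ((1 / 2 : ℂ) * (q (v - w) v + q w (v - w)))
    ((A : ℂ) * (a (v - w) * (a v + a w)))
  linarith

lemma leviPoly_re_le (h : IsDefiningFunction Ω U ρ) {A L c ε r : ℝ} (hA : 0 ≤ A) (hL : 1 ≤ L)
    {p x : E N} (hp : p ∈ frontier Ω) (h1 : ‖fderiv ℝ ρ p‖ ≤ L)
    (h2 : ‖fderiv ℝ (fderiv ℝ ρ) p‖ ≤ L)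
    (hlevi : c * ‖x - p‖ ^ 2 ≤ levi ρ p (x - p) + A * ‖complexify (fderiv ℝ ρ p) (x - p)‖ ^ 2)
    (hb : ball p r ⊆ U)
    (hH : ∀ x ∈ ball p r, ‖fderiv ℝ (fderiv ℝ ρ) x - fderiv ℝ (fderiv ℝ ρ) p‖ ≤ ε)
    (hε1 : ε ≤ 1) (hεc : ε ≤ c / 4) (hr1 : 2 * A * L * (L + 1) * r ≤ 1 / 2)
    (hr2 : 2 * A * L * (L + 1) * r ≤ c / 4) (hx : x ∈ Ω) (hxp : ‖x - p‖ < r) :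
    (leviPoly ρ A p x).re ≤ ρ x / 2 - c / 2 * ‖x - p‖ ^ 2 := by
  have ht := abs_le.1 (abs_taylor_le h.isOpen_nhd h.contDiffOn hb hH
    (by rwa [mem_ball, dist_eq_norm]))
  rw [h.eq_zero hp, sub_zero] at ht
  have hρ : ρ x ≤ 0 := h.le_zero (subset_closure hx)
  rw [leviPoly_re]
  have hl : |fderiv ℝ ρ p (x - p)| ≤ L * ‖x - p‖ := by
    rw [← Real.norm_eq_abs]
    exact ((fderiv ℝ ρ p).le_opNorm _).trans (by gcongr)
  have hHv : |fderiv ℝ (fderiv ℝ ρ) p (x - p) (x - p)| ≤ L * ‖x - p‖ ^ 2 := by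
    rw [← Real.norm_eq_abs, sq, ← mul_assoc]
    exact ((fderiv ℝ (fderiv ℝ ρ) p).le_opNorm₂ _ _).trans (by gcongr)
  set l := fderiv ℝ ρ p (x - p)
  set b := fderiv ℝ (fderiv ℝ ρ) p (x - p) (x - p)
  set t := ‖x - p‖
  have ht0 : 0 ≤ t := norm_nonneg _
  have hεt : ε * t ^ 2 ≤ 1 * t ^ 2 := by gcongr
  have hεt' : ε * t ^ 2 ≤ c / 4 * t ^ 2 := by gcongr
  have hb' := abs_le.1 hHv
  have hLt : t ^ 2 ≤ L * t ^ 2 := le_mul_of_one_le_left (by positivity) hL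
  have hl2 : |l| ≤ -ρ x + (L + 1) * t ^ 2 := by
    rw [abs_le]
    constructor <;> linarith [ht.1, ht.2, hb'.1, hb'.2]
  have hr0 : 0 ≤ r := ht0.trans hxp.le
  have hL0 : 0 ≤ L := zero_le_one.trans hL
  have hl3 : l ^ 2 ≤ L * r * (-ρ x + (L + 1) * t ^ 2) := by
    rw [← sq_abs, sq]
    have : L * t ≤ L * r := by gcongr
    exact mul_le_mul (hl.trans this) hl2 (abs_nonneg _) (mul_nonneg hL0 hr0)
  have hl4 : 2 * A * l ^ 2 ≤ 2 * A * (L * r * (-ρ x + (L + 1) * t ^ 2)) := by gcongr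
  have e1 : 2 * A * L * r ≤ 1 / 2 := by
    refine le_trans ?_ hr1
    have : 0 ≤ 2 * A * L * r * L := by positivity
    linarith
  have e2 : 2 * A * L * r * (-ρ x) ≤ 1 / 2 * (-ρ x) :=
    mul_le_mul_of_nonneg_right e1 (by linarith)
  have e3 : 2 * A * L * (L + 1) * r * t ^ 2 ≤ c / 4 * t ^ 2 := by gcongr
  linarith [ht.1, ht.2]

lemma apply_le_neg_bdist (h : IsDefiningFunction Ω U ρ) {L m ε r : ℝ} (hL : 1 ≤ L)
    {p x : E N} (hx : x ∈ Ω) (hp : p ∈ frontier Ω) (hd : dist x p = bdist Ω x)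
    (hm : m ≤ ‖fderiv ℝ ρ p‖) (h2 : ‖fderiv ℝ (fderiv ℝ ρ) p‖ ≤ L) (hb : ball p r ⊆ U)
    (hH : ∀ x ∈ ball p r, ‖fderiv ℝ (fderiv ℝ ρ) x - fderiv ℝ (fderiv ℝ ρ) p‖ ≤ ε)
    (hε1 : ε ≤ 1) (hr : (L + 1) * r ≤ m / 2) (hxr : bdist Ω x < r) :
    ρ x ≤ -(m / 2 * bdist Ω x) := by
  have hnorm : ‖x - p‖ = bdist Ω x := by rw [← hd, dist_eq_norm]
  have ht := abs_le.1 (abs_taylor_le h.isOpen_nhd h.contDiffOn hb hH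
    (by rwa [mem_ball, hd]))
  have hHv : |fderiv ℝ (fderiv ℝ ρ) p (x - p) (x - p)| ≤ L * ‖x - p‖ ^ 2 := by
    rw [← Real.norm_eq_abs, sq, ← mul_assoc]
    exact ((fderiv ℝ (fderiv ℝ ρ) p).le_opNorm₂ _ _).trans (by gcongr)
  have hl := h.fderiv_apply_le hx hp hd
  rw [h.eq_zero hp, sub_zero, hnorm] at ht
  rw [hnorm] at hl hHv
  set t := bdist Ω x
  have ht0 : 0 ≤ t := Metric.infDist_nonneg
  have hεt : ε * t ^ 2 ≤ 1 * t ^ 2 := by gcongr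
  have hmt : m * t ≤ ‖fderiv ℝ ρ p‖ * t := by gcongr
  have e1 : (L + 1) * t * t ≤ m / 2 * t := by
    refine mul_le_mul_of_nonneg_right (le_trans ?_ hr) ht0
    gcongr
  have e2 : 0 ≤ L * t ^ 2 := by positivity
  linarith [ht.2, (abs_le.1 hHv).2]

lemma nonempty_supportData (h : IsDefiningFunction Ω U ρ) {π : E N → E N}
    (hπ : IsClosestPointSelection Ω π) : Nonempty (SupportData Ω π) := by
  obtain ⟨A, hA, c, hc, hlevi⟩ := h.exists_levi_bound
  obtain ⟨L, hL, m, hm, hLm⟩ := h.exists_bounds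
  obtain ⟨r₀, hr₀, hball⟩ := h.exists_radius (ε := min 1 (c / 4)) (by positivity)
  obtain ⟨D, hD⟩ := Metric.isBounded_iff.1 (Metric.isBounded_closure_iff.2 h.isBounded)
  set B := 2 * A * L * (L + 1) + (L + 1)
  have hL0 : 0 ≤ L := zero_le_one.trans hL
  have hB : 0 < B := by positivity
  set μ := min (min (1 / 2) (c / 4)) (m / 2)
  set r := min (min 1 r₀) (μ / B)
  have hr : 0 < r := by positivity
  have hrr₀ : r ≤ r₀ := (min_le_left _ _).trans (min_le_right _ _)
  have hrB : B * r ≤ μ := by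
    rw [mul_comm, ← le_div_iff₀ hB]; exact min_le_right _ _
  have hB1 : 2 * A * L * (L + 1) * r ≤ B * r := by
    gcongr; simp only [B]; linarith
  have hB2 : (L + 1) * r ≤ B * r := by
    gcongr; simp only [B]; linarith [show 0 ≤ 2 * A * L * (L + 1) by positivity]
  have hμ1 : μ ≤ 1 / 2 := (min_le_left _ _).trans (min_le_left _ _)
  have hμ2 : μ ≤ c / 4 := (min_le_left _ _).trans (min_le_right _ _)
  have hμ3 : μ ≤ m / 2 := min_le_right _ _
  have hsub : ∀ p : E N, ball p r ⊆ ball p r₀ := fun p => ball_subset_ball hrr₀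
  have hb : ∀ p ∈ frontier Ω, ball p r ⊆ U := fun p hp => (hsub p).trans (hball p hp).1
  have hH : ∀ p ∈ frontier Ω, ∀ x ∈ ball p r,
      ‖fderiv ℝ (fderiv ℝ ρ) x - fderiv ℝ (fderiv ℝ ρ) p‖ ≤ min 1 (c / 4) :=
    fun p hp x hx => (hball p hp).2 x (hsub p hx)
  set K := (L + 1) + A * L ^ 2 + 2 * L / r + 1 / m
  have hK0 : 0 ≤ A * L ^ 2 := by positivity
  have hK1 : 0 ≤ 2 * L / r := by positivity
  have hK2 : 0 ≤ 1 / m := by positivity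
  exact ⟨{
    c := min 1 (min (m / 4) (c / 2))
    K := K
    r := r
    D := max 1 D
    f := leviPoly ρ A
    a := fun p => complexify (fderiv ℝ ρ p)
    c_pos := by positivity
    c_le := min_le_left _ _
    K_ge := by simp only [K]; linarith
    r_pos := hr
    r_le := (min_le_left _ _).trans (min_le_left _ _)
    D_ge := le_max_left _ _
    isOpen := h.isOpen
    sel := hπ
    dist_le := fun x hx y hy => by
      rw [← dist_eq_norm]
      exact (hD hx hy).trans (le_max_right _ _)
    diff := fun p _ => differentiable_leviPoly ρ A p
    f_self := fun p _ => by simp [leviPoly]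
    f_lin := fun p hp x y => by
      refine (norm_leviPoly_sub_le hA (hLm p hp).1 (hLm p hp).2.1 x y).trans ?_
      gcongr
      simp only [K]; linarith
    re_le := fun p hp x hx hxp => by
      obtain ⟨hq, hd⟩ := hπ x hx
      have hδ : bdist Ω x ≤ ‖x - p‖ := by
        rw [← dist_eq_norm]; exact Metric.infDist_le_dist_of_mem hp
      have h1 := h.leviPoly_re_le hA hL hp (hLm p hp).1 (hLm p hp).2.1 (hlevi p hp (x - p))
        (hb p hp) (hH p hp) (min_le_left _ _) (min_le_right _ _) (by linarith) (by linarith)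
        hx hxp
      have h2 := h.apply_le_neg_bdist hL hx hq hd (hLm _ hq).2.2 (hLm _ hq).2.1 (hb _ hq)
        (hH _ hq) (min_le_left _ _) (by linarith) (hδ.trans_lt hxp)
      have h3 : min 1 (min (m / 4) (c / 2)) * ‖x - p‖ ^ 2 ≤ c / 2 * ‖x - p‖ ^ 2 := by
        gcongr
        exact (min_le_right _ _).trans (min_le_right _ _)
      have h4 : min 1 (min (m / 4) (c / 2)) * bdist Ω x ≤ m / 4 * bdist Ω x :=
        mul_le_mul_of_nonneg_right ((min_le_right _ _).trans (min_le_left _ _))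
          Metric.infDist_nonneg
      linarith
    a_le := fun p hp v => by
      refine (ContinuousLinearMap.le_opNorm _ v).trans ?_
      rw [norm_complexify]
      have := (hLm p hp).1
      gcongr
      simp only [K]; linarith
    a_lip := fun p hp q hq v => by
      rw [← sub_apply, ← complexify_sub]
      refine (ContinuousLinearMap.le_opNorm _ v).trans ?_
      rw [norm_complexify]
      gcongr
      by_cases hpq : ‖p - q‖ < r
      · have h1 := norm_fderiv_sub_le h.isOpen_nhd h.contDiffOn (hb q hq) (hH q hq)
          (x := p) (by rwa [mem_ball, dist_eq_norm])
        have h2 := (fderiv ℝ (fderiv ℝ ρ) q).le_opNorm (p - q)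
        have h3 : ‖fderiv ℝ (fderiv ℝ ρ) q‖ * ‖p - q‖ ≤ L * ‖p - q‖ := by
          gcongr; exact (hLm q hq).2.1
        have h4 : min 1 (c / 4) * ‖p - q‖ ≤ 1 * ‖p - q‖ := by
          gcongr; exact min_le_left _ _
        have h5 : (L + 1) * ‖p - q‖ ≤ K * ‖p - q‖ := by
          gcongr; simp only [K]; linarith
        have h6 := norm_sub_norm_le (fderiv ℝ ρ p - fderiv ℝ ρ q)
          (fderiv ℝ (fderiv ℝ ρ) q (p - q))
        linarith
      · have h1 := norm_sub_le (fderiv ℝ ρ p) (fderiv ℝ ρ q)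
        have h2 : 2 * L / r * r ≤ 2 * L / r * ‖p - q‖ := by
          gcongr; exact not_lt.1 hpq
        rw [div_mul_cancel₀ _ hr.ne'] at h2
        have h3 : 2 * L / r * ‖p - q‖ ≤ K * ‖p - q‖ := by
          gcongr; simp only [K]; linarith
        linarith [(hLm p hp).1, (hLm q hq).1]
    ncomp_le := fun z hz v => by
      have hp := (hπ z hz).1
      have h1 := h.ncomp_mul_le hπ hz v
      have h2 : 0 ≤ ncomp Ω π z v := div_nonneg (norm_nonneg _) Metric.infDist_nonneg
      have h3 : m * ncomp Ω π z v ≤ ‖complexify (fderiv ℝ ρ (π z)) v‖ :=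
        le_trans (by gcongr; exact (hLm _ hp).2.2) h1
      have h4 : 1 / m * ‖complexify (fderiv ℝ ρ (π z)) v‖ ≤
          K * ‖complexify (fderiv ℝ ρ (π z)) v‖ := by
        gcongr; simp only [K]; linarith
      refine le_trans ?_ h4
      rw [one_div, inv_mul_eq_div, le_div_iff₀ hm]
      linarith }⟩

end IsDefiningFunction

lemma IsStronglyPseudoconvexDomain.exists_isDefiningFunction {α : ℝ} {Ω : Set (E N)}
    (hΩ : IsStronglyPseudoconvexDomain 2 α Ω) : ∃ U ρ, IsDefiningFunction Ω U ρ := by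
  obtain ⟨ho, -, hb, U, ρ, hU, hsub, ⟨hρ, -⟩, heq, hne, hlevi⟩ := hΩ
  refine ⟨U, ρ, ho, hb, hU, hsub, by exact_mod_cast hρ, heq, hne, fun p hp v hv hav => ?_⟩
  refine hlevi p hp v hv ?_ ?_
  · rw [← complexify_re, hav, Complex.zero_re]
  · rw [← neg_eq_zero, ← complexify_im, hav, Complex.zero_im]

/-- Lower bound for the Kobayashi distance in terms of the complex
normal component. -/
theorem stmt2 {N : ℕ} {α : ℝ} (hα : α ∈ Set.Ioc (0:ℝ) 1)
    (Ω : Set (E N)) (hΩ : IsStronglyPseudoconvexDomain 2 α Ω)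
    (π : E N → E N) (hπ : IsClosestPointSelection Ω π) :
    ∃ c : ℝ, 0 < c ∧ ∀ z ∈ Ω, ∀ w ∈ Ω,
      Real.log (1 + c * (ncomp Ω π z (z - w) /
        (Real.sqrt (bdist Ω z) * Real.sqrt (bdist Ω w)))) ≤ kobayashi Ω z w := by
  obtain ⟨U, ρ, h⟩ := hΩ.exists_isDefiningFunction
  obtain ⟨S⟩ := h.nonempty_supportData hπ
  exact S.exists_log_le_kobayashi (discConnected hΩ.1 hΩ.2.1)

end InvDist
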